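/- Let (Y,θ) be a generating system of k nondegenerate regular A-correspondences, and for each i,j let ℰY_i = Y_i ⊗_A O_{Y_1} and ℛθ_{ij} = ν_{ji}^{-1}(θ_{ij} ⊗ 1_{O_{Y_1}})ν_{ij}. Then (ℰY, ℛθ) is a generating system of O_{Y_1}-correspondences: each ℛθ_{ij} : ℰY_i ⊗_{O_{Y_1}} ℰY_j → ℰY_j ⊗_{O_{Y_1}} ℰY_i is an isomorphism with ℛθ_{ii} = id and ℛθ_{ij} = ℛθ_{ji}^{-1}, and the ℛθ_{ij} satisfy the hexagonal relations. -/

import Mathlib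

/- ############################################################
   Common framework: C*-correspondences, interior tensor products
   (characterized relationally), representations, Cuntz–Pimsner algebras,
   product systems over ℕ^k, generating systems, and the ℰ / ℛθ
   constructions of the paper (characterized relationally).
   ############################################################ -/

noncomputable section

open Filter Topology

universe u

/-- A C*-correspondence over a (not necessarily unital) C*-algebra `A`:
a right Hilbert `A`-module `X` together with a left action of `A` by
adjointable (bounded) operators.  The rank-one operators `θ_{x,y}` are
bundled as data together with their defining property. -/
structure Corr (A : Type u) [NonUnitalCStarAlgebra A] : Type (u + 1) where
  X : Type u
  [nacg : NormedAddCommGroup X]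
  [nsp : NormedSpace ℂ X]
  [cmpl : CompleteSpace X]
  /-- right action of `A` -/
  ract : X → A → X
  /-- `A`-valued inner product -/
  inner : X → X → A
  /-- left action `φ : A → L(X)` by adjointable operators -/
  lactL : A → X →L[ℂ] X
  /-- the rank-one ("compact") operators `θ_{x,y} z = x ⬝ ⟨y, z⟩` -/
  rankOne : X → X → X →L[ℂ] X
  ract_add_left : ∀ x y a, ract (x + y) a = ract x a + ract y a
  ract_add_right : ∀ x a b, ract x (a + b) = ract x a + ract x b
  ract_mul : ∀ x a b, ract x (a * b) = ract (ract x a) b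
  ract_smul : ∀ (c : ℂ) x a, ract (c • x) a = c • ract x a
  ract_smul' : ∀ (c : ℂ) x a, ract x (c • a) = c • ract x a
  inner_add_right : ∀ x y z, inner x (y + z) = inner x y + inner x z
  inner_smul_right : ∀ (c : ℂ) x y, inner x (c • y) = c • inner x y
  inner_star : ∀ x y, star (inner x y) = inner y x
  inner_ract_right : ∀ x y a, inner x (ract y a) = inner x y * a
  norm_eq : ∀ x, ‖x‖ ^ 2 = ‖inner x x‖
  lact_add : ∀ a b, lactL (a + b) = lactL a + lactL b
  lact_mul : ∀ a b, lactL (a * b) = (lactL a).comp (lactL b)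
  lact_smul : ∀ (c : ℂ) a, lactL (c • a) = c • lactL a
  lact_adjoint : ∀ a x y, inner (lactL a x) y = inner x (lactL (star a) y)
  rankOne_apply : ∀ x y z, rankOne x y z = ract x (inner y z)

attribute [instance] Corr.nacg Corr.nsp Corr.cmpl

variable {A : Type u} [NonUnitalCStarAlgebra A]

/-- Nondegeneracy: `A·X` is (topologically) all of `X`. -/
def Corr.Nondeg (W : Corr A) : Prop :=
  closure (Submodule.span ℂ {y : W.X | ∃ a x, y = W.lactL a x} : Set W.X) = Set.univ

/-- Regularity: the left action is injective and takes values in the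
compact operators (the closed span of the rank-one operators). -/
def Corr.Regular (W : Corr A) : Prop :=
  (∀ a, W.lactL a = 0 → a = 0) ∧
    ∀ a, W.lactL a ∈
      closure (Submodule.span ℂ {T : W.X →L[ℂ] W.X | ∃ x y, T = W.rankOne x y} :
        Set (W.X →L[ℂ] W.X))

/-- standing hypotheses of the paper: nondegenerate and regular -/
def Corr.Reg (W : Corr A) : Prop := W.Nondeg ∧ W.Regular

/-- a bare function which is a continuous `ℂ`-linear map -/
structure IsCLMap {E F : Type u} [NormedAddCommGroup E] [NormedSpace ℂ E]
    [NormedAddCommGroup F] [NormedSpace ℂ F] (f : E → F) : Prop where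
  map_add : ∀ x y, f (x + y) = f x + f y
  map_smul : ∀ (c : ℂ) x, f (c • x) = c • f x
  cont : Continuous f

/-- a map of correspondences over the same algebra which is an isomorphism -/
structure IsCorrIsoFun (W Z : Corr A) (f : W.X → Z.X) : Prop where
  bijective : Function.Bijective f
  map_add : ∀ x y, f (x + y) = f x + f y
  map_smul : ∀ (c : ℂ) x, f (c • x) = c • f x
  map_inner : ∀ x y, Z.inner (f x) (f y) = W.inner x y
  map_ract : ∀ x a, f (W.ract x a) = Z.ract (f x) a
  map_lact : ∀ a x, f (W.lactL a x) = Z.lactL a (f x)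

/-- an isomorphism of correspondences over the same algebra (bundled) -/
structure CorrIso (W Z : Corr A) : Type u where
  toFun : W.X → Z.X
  invFun : Z.X → W.X
  left_inv : ∀ x, invFun (toFun x) = x
  right_inv : ∀ y, toFun (invFun y) = y
  map_add : ∀ x y, toFun (x + y) = toFun x + toFun y
  map_smul : ∀ (c : ℂ) x, toFun (c • x) = c • toFun x
  map_inner : ∀ x y, Z.inner (toFun x) (toFun y) = W.inner x y
  map_ract : ∀ x a, toFun (W.ract x a) = Z.ract (toFun x) a
  map_lact : ∀ a x, toFun (W.lactL a x) = Z.lactL a (toFun x)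

/-- an isomorphism of correspondences lying over an isomorphism `Φ` of the
coefficient algebras -/
structure CorrIsoOver {B : Type u} [NonUnitalCStarAlgebra B]
    (Φ : A → B) (W : Corr A) (Z : Corr B) : Type u where
  toFun : W.X → Z.X
  bijective : Function.Bijective toFun
  map_add : ∀ x y, toFun (x + y) = toFun x + toFun y
  map_smul : ∀ (c : ℂ) x, toFun (c • x) = c • toFun x
  map_inner : ∀ x y, Z.inner (toFun x) (toFun y) = Φ (W.inner x y)
  map_ract : ∀ x a, toFun (W.ract x a) = Z.ract (toFun x) (Φ a)
  map_lact : ∀ a x, toFun (W.lactL a x) = Z.lactL (Φ a) (toFun x)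

/-- `T`, together with the bilinear map `m`, is a realization of the
balanced (interior) tensor product `W ⊗_A V` of correspondences over `A`. -/
structure IsTensor (W V T : Corr A) (m : W.X → V.X → T.X) : Prop where
  add_left : ∀ x x' y, m (x + x') y = m x y + m x' y
  add_right : ∀ x y y', m x (y + y') = m x y + m x y'
  smul_left : ∀ (c : ℂ) x y, m (c • x) y = c • m x y
  smul_right : ∀ (c : ℂ) x y, m x (c • y) = c • m x y
  balanced : ∀ x a y, m (W.ract x a) y = m x (V.lactL a y)
  inner : ∀ x y x' y',
    T.inner (m x y) (m x' y') = V.inner y (V.lactL (W.inner x x') y')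
  ract : ∀ x y a, T.ract (m x y) a = m x (V.ract y a)
  lact : ∀ a x y, T.lactL a (m x y) = m (W.lactL a x) y
  dense : closure (Submodule.span ℂ {z : T.X | ∃ x y, z = m x y} : Set T.X) = Set.univ

variable {B : Type u} [NonUnitalCStarAlgebra B]

/-- `π : A → B` is a *-homomorphism (stated elementwise) -/
structure IsStarHom (π : A → B) : Prop where
  map_add : ∀ a b, π (a + b) = π a + π b
  map_mul : ∀ a b, π (a * b) = π a * π b
  map_star : ∀ a, π (star a) = star (π a)
  map_smul : ∀ (c : ℂ) a, π (c • a) = c • π a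

/-- `(π, t)` is a representation (Toeplitz representation) of the
correspondence `W` in the C*-algebra `B`. -/
structure IsRep (W : Corr A) (π : A → B) (t : W.X → B) : Prop where
  hom : IsStarHom π
  t_add : ∀ x y, t (x + y) = t x + t y
  t_smul : ∀ (c : ℂ) x, t (c • x) = c • t x
  lact : ∀ a x, t (W.lactL a x) = π a * t x
  ract : ∀ x a, t (W.ract x a) = t x * π a
  inner : ∀ x y, star (t x) * t y = π (W.inner x y)

/-- Cuntz–Pimsner covariance of a representation of a *regular*
correspondence: whenever `φ(a)` is approximated in norm by finite sums of
rank-one operators `θ_{x,y}`, `π(a)` is approximated by the corresponding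
sums `t(x) t(y)*`.  (For regular correspondences this is equivalent to
`π = t⁽¹⁾ ∘ φ`.) -/
def CPCov (W : Corr A) (π : A → B) (t : W.X → B) : Prop :=
  ∀ (a : A) (N : ℕ → ℕ) (x y : ∀ n, Fin (N n) → W.X),
    Tendsto (fun n => ∑ r, W.rankOne (x n r) (y n r)) atTop (𝓝 (W.lactL a)) →
    Tendsto (fun n => ∑ r, t (x n r) * star (t (y n r))) atTop (𝓝 (π a))

/-- The Cuntz–Pimsner algebra of a correspondence `W`: a C*-algebra `O`
together with a universal covariant representation `(π, t)`:  `(π,t)` is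
covariant, `π` is injective, `O` is generated by the images of `π` and `t`,
and every covariant representation factors uniquely through `O`. -/
structure CPAlg (W : Corr A) : Type (u + 1) where
  O : Type u
  [alg : NonUnitalCStarAlgebra O]
  π : A → O
  t : W.X → O
  isRep : IsRep W π t
  covariant : CPCov W π t
  inj : Function.Injective π
  gen : ∀ S : Set O, IsClosed S →
    (∀ a, π a ∈ S) → (∀ x, t x ∈ S) →
    (∀ p q, p ∈ S → q ∈ S → p + q ∈ S) →
    (∀ p q, p ∈ S → q ∈ S → p * q ∈ S) →
    (∀ (c : ℂ) p, p ∈ S → c • p ∈ S) →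
    (∀ p, p ∈ S → star p ∈ S) → ∀ z, z ∈ S
  universal : ∀ (C : Type u) [NonUnitalCStarAlgebra C],
    ∀ (π' : A → C) (t' : W.X → C), IsRep W π' t' → CPCov W π' t' →
      ∃! h : O →⋆ₙₐ[ℂ] C, (∀ a, h (π a) = π' a) ∧ ∀ x, h (t x) = t' x

attribute [instance] CPAlg.alg

/- ##################  product systems over ℕ^k  ################## -/

/-- the `i`-th standard generator of `ℕ^k` -/
def egen {k : ℕ} (i : Fin k) : Fin k → ℕ := Pi.single i 1

/-- A product system over `ℕ^k` of (nondegenerate regular) correspondences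
over `A`:  fibers `fib s`, an associative multiplication implementing
isomorphisms `fib s ⊗_A fib t ≅ fib (s+t)`, and `fib 0 = A` (witnessed by
the unit map). -/
structure PSys (A : Type u) [NonUnitalCStarAlgebra A] (k : ℕ) : Type (u + 1) where
  fib : (Fin k → ℕ) → Corr A
  reg : ∀ s, (fib s).Reg
  mul : ∀ s t, (fib s).X → (fib t).X → (fib (s + t)).X
  isTensor : ∀ s t, IsTensor (fib s) (fib t) (fib (s + t)) (mul s t)
  assoc : ∀ s t u x y z,
    HEq (mul (s + t) u (mul s t x y) z) (mul s (t + u) x (mul t u y z))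
  unit : A → (fib 0).X
  unit_bij : Function.Bijective unit
  unit_add : ∀ a b, unit (a + b) = unit a + unit b
  unit_smul : ∀ (c : ℂ) a, unit (c • a) = c • unit a
  unit_inner : ∀ a b, (fib 0).inner (unit a) (unit b) = star a * b
  unit_lact : ∀ a b, (fib 0).lactL a (unit b) = unit (a * b)
  unit_ract : ∀ a b, (fib 0).ract (unit a) b = unit (a * b)
  unit_mul_left : ∀ s a x, HEq (mul 0 s (unit a) x) ((fib s).lactL a x)
  unit_mul_right : ∀ s x a, HEq (mul s 0 x (unit a)) ((fib s).ract x a)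

/-- a representation of a product system in a C*-algebra `B` -/
structure PSRep {k : ℕ} (Xs : PSys A k) (B : Type u) [NonUnitalCStarAlgebra B] :
    Type u where
  π : A → B
  ψ : ∀ s, (Xs.fib s).X → B
  isRep : ∀ s, IsRep (Xs.fib s) π (ψ s)
  ψ_zero : ∀ a, ψ 0 (Xs.unit a) = π a
  mul : ∀ s t x y, ψ s x * ψ t y = ψ (s + t) (Xs.mul s t x y)

/-- Cuntz–Pimsner covariance of a representation of a product system -/
def PSCPCov {k : ℕ} {Xs : PSys A k} {B : Type u} [NonUnitalCStarAlgebra B]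
    (r : PSRep Xs B) : Prop :=
  ∀ s, CPCov (Xs.fib s) r.π (r.ψ s)

/-- The Cuntz–Pimsner algebra `𝒪(X)` of a product system. -/
structure PSCPAlg {k : ℕ} (Xs : PSys A k) : Type (u + 1) where
  O : Type u
  [alg : NonUnitalCStarAlgebra O]
  rep : PSRep Xs O
  covariant : PSCPCov rep
  inj : Function.Injective rep.π
  gen : ∀ S : Set O, IsClosed S →
    (∀ a, rep.π a ∈ S) → (∀ s x, rep.ψ s x ∈ S) →
    (∀ p q, p ∈ S → q ∈ S → p + q ∈ S) →
    (∀ p q, p ∈ S → q ∈ S → p * q ∈ S) →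
    (∀ (c : ℂ) p, p ∈ S → c • p ∈ S) →
    (∀ p, p ∈ S → star p ∈ S) → ∀ z, z ∈ S
  universal : ∀ (C : Type u) [NonUnitalCStarAlgebra C],
    ∀ r : PSRep Xs C, PSCPCov r →
      ∃! h : O →⋆ₙₐ[ℂ] C,
        (∀ a, h (rep.π a) = r.π a) ∧ ∀ s x, h (rep.ψ s x) = r.ψ s x

attribute [instance] PSCPAlg.alg

/- ##################  generating systems  ################## -/

/-- a realization of a triple tensor product `W1 ⊗ W2 ⊗ W3` carrying both
a left pairing `(W1 ⊗ W2) ⊗ W3` and a right pairing `W1 ⊗ (W2 ⊗ W3)` -/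
structure Trip (W1 W2 W3 : Corr A) (T12 : Corr A) (m12 : W1.X → W2.X → T12.X)
    (T23 : Corr A) (m23 : W2.X → W3.X → T23.X) (P : Corr A) : Type u where
  lp : T12.X → W3.X → P.X
  rp : W1.X → T23.X → P.X
  lt : IsTensor T12 W3 P lp
  rt : IsTensor W1 T23 P rp
  compat : ∀ x y z, lp (m12 x y) z = rp x (m23 y z)

/-- the hexagonal relation for a triple of flip isomorphisms
`θij, θil, θjl`, stated relative to arbitrary realizations of the six
triple tensor products. -/
def HexProp (Yi Yj Yl : Corr A)
    (Tij Tji Til Tli Tjl Tlj : Corr A)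
    (mij : Yi.X → Yj.X → Tij.X) (mji : Yj.X → Yi.X → Tji.X)
    (mil : Yi.X → Yl.X → Til.X) (mli : Yl.X → Yi.X → Tli.X)
    (mjl : Yj.X → Yl.X → Tjl.X) (mlj : Yl.X → Yj.X → Tlj.X)
    (θij : Tij.X → Tji.X) (θil : Til.X → Tli.X) (θjl : Tjl.X → Tlj.X) : Prop :=
  ∀ (P1 P2 P3 P4 P5 P6 : Corr A)
    (R1 : Trip Yi Yj Yl Tij mij Tjl mjl P1)
    (R2 : Trip Yj Yi Yl Tji mji Til mil P2)
    (R3 : Trip Yj Yl Yi Tjl mjl Tli mli P3)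
    (R4 : Trip Yl Yj Yi Tlj mlj Tji mji P4)
    (R5 : Trip Yi Yl Yj Til mil Tlj mlj P5)
    (R6 : Trip Yl Yi Yj Tli mli Tij mij P6)
    (F1 : P1.X → P2.X) (F2 : P2.X → P3.X) (F3 : P3.X → P4.X)
    (F4 : P1.X → P5.X) (F5 : P5.X → P6.X) (F6 : P6.X → P4.X),
    IsCLMap F1 → IsCLMap F2 → IsCLMap F3 →
    IsCLMap F4 → IsCLMap F5 → IsCLMap F6 →
    (∀ u z, F1 (R1.lp u z) = R2.lp (θij u) z) →
    (∀ y v, F2 (R2.rp y v) = R3.rp y (θil v)) →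
    (∀ u z, F3 (R3.lp u z) = R4.lp (θjl u) z) →
    (∀ x v, F4 (R1.rp x v) = R5.rp x (θjl v)) →
    (∀ u z, F5 (R5.lp u z) = R6.lp (θil u) z) →
    (∀ x v, F6 (R6.rp x v) = R4.rp x (θij v)) →
    ∀ w, F3 (F2 (F1 w)) = F6 (F5 (F4 w))

/-- A generating system `(Y, θ)` of `k` correspondences over `A`:
correspondences `Y i`, chosen realizations `T i j` of the tensor products
`Y i ⊗_A Y j`, and flip isomorphisms `θ i j : Y i ⊗ Y j → Y j ⊗ Y i` with
`θ i i = id`, `θ j i = (θ i j)⁻¹`, satisfying the hexagonal relations. -/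
structure GenSys (A : Type u) [NonUnitalCStarAlgebra A] (k : ℕ) : Type (u + 1) where
  Y : Fin k → Corr A
  reg : ∀ i, (Y i).Reg
  T : Fin k → Fin k → Corr A
  tmul : ∀ i j, (Y i).X → (Y j).X → (T i j).X
  isTensor : ∀ i j, IsTensor (Y i) (Y j) (T i j) (tmul i j)
  θ : ∀ i j, CorrIso (T i j) (T j i)
  θ_diag : ∀ i x y, (θ i i).toFun (tmul i i x y) = tmul i i x y
  θ_symm : ∀ i j z, (θ j i).toFun ((θ i j).toFun z) = z
  hex : ∀ i j l, HexProp (Y i) (Y j) (Y l) (T i j) (T j i) (T i l) (T l i)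
    (T j l) (T l j) (tmul i j) (tmul j i) (tmul i l) (tmul l i) (tmul j l)
    (tmul l j) ((θ i j).toFun) ((θ i l).toFun) ((θ j l).toFun)

/-- the generating system obtained by keeping only `Y 1, …, Y m` -/
def GenSys.restrict {k : ℕ} (G : GenSys A k) (m : ℕ) (h : m ≤ k) : GenSys A m where
  Y i := G.Y (Fin.castLE h i)
  reg i := G.reg _
  T i j := G.T (Fin.castLE h i) (Fin.castLE h j)
  tmul i j := G.tmul _ _
  isTensor i j := G.isTensor _ _
  θ i j := G.θ _ _
  θ_diag i := G.θ_diag _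
  θ_symm i j := G.θ_symm _ _
  hex i j l := G.hex _ _ _

/-- `X` is *the* product system (over `ℕ^k`) generated by the generating
system `G` (Fowler–Sims); witnessed by compatible isomorphisms on the
generating fibers. -/
structure Generates {k : ℕ} (G : GenSys A k) (Xs : PSys A k) : Type u where
  ι : ∀ i, CorrIso (G.Y i) (Xs.fib (egen i))
  κ : ∀ i j, CorrIso (G.T i j) (Xs.fib (egen i + egen j))
  κ_mul : ∀ i j x y,
    (κ i j).toFun (G.tmul i j x y) =
      Xs.mul (egen i) (egen j) ((ι i).toFun x) ((ι j).toFun y)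
  θ_compat : ∀ i j z,
    HEq ((κ j i).toFun ((G.θ i j).toFun z)) ((κ i j).toFun z)

/- ############  mixed tensor products `W ⊗_A O` and `W ⊗_A V`  ############ -/

/-- `Z` (a correspondence over the C*-algebra `O`), with map `m`, is a
realization of the right Hilbert `O`-module `W ⊗_A O`, where `O` is an
`A`-algebra via `πA`.  (No condition on the left action of `O` on `Z`.) -/
structure MixedMod (W : Corr A) (O : Type u) [NonUnitalCStarAlgebra O]
    (πA : A → O) (Z : Corr O) (m : W.X → O → Z.X) : Prop where
  add_left : ∀ x x' S, m (x + x') S = m x S + m x' S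
  add_right : ∀ x S S', m x (S + S') = m x S + m x S'
  smul_left : ∀ (c : ℂ) x S, m (c • x) S = c • m x S
  smul_right : ∀ (c : ℂ) x S, m x (c • S) = c • m x S
  balanced : ∀ x a S, m (W.ract x a) S = m x (πA a * S)
  ract : ∀ x S T, Z.ract (m x S) T = m x (S * T)
  inner : ∀ x S y T, Z.inner (m x S) (m y T) = star S * (πA (W.inner x y) * T)
  dense : closure (Submodule.span ℂ {z : Z.X | ∃ x S, z = m x S} : Set Z.X) = Set.univ

/-- `P`, with pairing `p`, is a realization of the balanced tensor product
`W ⊗_A V` where `W` is a correspondence over `A` and `V` a correspondence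
over the `A`-algebra `O` (via `πA`); the left `A`-action is `πA`-compatible. -/
structure MixedPair (W : Corr A) {O : Type u} [NonUnitalCStarAlgebra O]
    (πA : A → O) (V P : Corr O) (p : W.X → V.X → P.X) : Prop where
  add_left : ∀ x x' v, p (x + x') v = p x v + p x' v
  add_right : ∀ x v v', p x (v + v') = p x v + p x v'
  smul_left : ∀ (c : ℂ) x v, p (c • x) v = c • p x v
  smul_right : ∀ (c : ℂ) x v, p x (c • v) = c • p x v
  balanced : ∀ x a v, p (W.ract x a) v = p x (V.lactL (πA a) v)
  inner : ∀ x v x' v',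
    P.inner (p x v) (p x' v') = V.inner v (V.lactL (πA (W.inner x x')) v')
  ract : ∀ x v S, P.ract (p x v) S = p x (V.ract v S)
  lact_pi : ∀ a x v, P.lactL (πA a) (p x v) = p (W.lactL a x) v
  dense : closure (Submodule.span ℂ {z : P.X | ∃ x v, z = p x v} : Set P.X) = Set.univ

/- ############  the correspondence `ℰYᵢ = Yᵢ ⊗_A 𝒪(Y₁)`  ############ -/

/-- `Z = Yi ⊗_A 𝒪(Y1)` with the left `𝒪(Y1)`-action determined by the flip
`θ : Y1 ⊗ Yi → Yi ⊗ Y1` (`T` and `T'` are realizations of these tensor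
products):  `π(a)` acts by `φ(a) ⊗ 1`, and `t(x)·(y ⊗ S) = (1 ⊗ V)(θ ⊗ 1)
(x ⊗ y ⊗ S)`. -/
structure ECorrData (Y1 Yi : Corr A)
    (T : Corr A) (mT : Y1.X → Yi.X → T.X)
    (T' : Corr A) (mT' : Yi.X → Y1.X → T'.X)
    (θ : T.X → T'.X)
    (C : CPAlg Y1) (Z : Corr C.O) (m : Yi.X → C.O → Z.X) : Prop where
  mod : MixedMod Yi C.O C.π Z m
  lact_pi : ∀ a y S, Z.lactL (C.π a) (m y S) = m (Yi.lactL a y) S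
  lact_t : ∃ μ : T'.X → C.O → Z.X,
    (∀ S, IsCLMap fun u => μ u S) ∧
    (∀ y u S, μ (mT' y u) S = m y (C.t u * S)) ∧
    ∀ x y S, Z.lactL (C.t x) (m y S) = μ (θ (mT x y)) S

/-- `Z = Yi ⊗_A 𝒪(Y p)` for a generating system `G`, with left action
determined by `θ p i` -/
def ECorr {k : ℕ} (G : GenSys A k) (p i : Fin k) (C : CPAlg (G.Y p))
    (Z : Corr C.O) (m : (G.Y i).X → C.O → Z.X) : Prop :=
  ECorrData (G.Y p) (G.Y i) (G.T p i) (G.tmul p i) (G.T i p) (G.tmul i p)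
    ((G.θ p i).toFun) C Z m

/-- `Z = Y j ⊗_A 𝒪(Y 1 ∗ ⋯ ∗ Y m)` with the left action of the
Cuntz–Pimsner algebra of the product system determined on the generators
`σ i = ψ_{e i}` via the flips `θ i j` and the absorption maps. -/
structure EPCorr {k : ℕ} (G : GenSys A k) {m : ℕ} (hm : m ≤ k)
    (Xs : PSys A m) (gen : Generates (G.restrict m hm) Xs) (C : PSCPAlg Xs)
    (j : Fin k) (Z : Corr C.O) (mm : (G.Y j).X → C.O → Z.X) : Prop where
  mod : MixedMod (G.Y j) C.O C.rep.π Z mm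
  lact_pi : ∀ a y S, Z.lactL (C.rep.π a) (mm y S) = mm ((G.Y j).lactL a y) S
  lact_t : ∀ i : Fin m,
    ∃ μ : (G.T j (Fin.castLE hm i)).X → C.O → Z.X,
      (∀ S, IsCLMap fun u => μ u S) ∧
      (∀ y u S, μ (G.tmul j (Fin.castLE hm i) y u) S =
        mm y (C.rep.ψ (egen i) ((gen.ι i).toFun u) * S)) ∧
      ∀ x y S, Z.lactL (C.rep.ψ (egen i) ((gen.ι i).toFun x)) (mm y S) =
        μ ((G.θ (Fin.castLE hm i) j).toFun (G.tmul (Fin.castLE hm i) j x y)) S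

/- ############  the isomorphism `ℛθ = ν⁻¹ (θ ⊗ 1) ν`  ############ -/

/-- Witness data expressing that `R : Zi ⊗_O Zj → Zj ⊗_O Zi` is the map
`ℛθ_{ij} = ν_{ji}⁻¹ (θ_{ij} ⊗ 1_O) ν_{ij}` of the paper, where
`Zi = Yi ⊗_A O`, `O = 𝒪(Y1)`, and `ν_{ij} : (Yi ⊗ O) ⊗_O (Yj ⊗ O) ≅
Yi ⊗ Yj ⊗ O` is the canonical absorption isomorphism. -/
structure RTheta (O : Type u) [NonUnitalCStarAlgebra O] (πA : A → O)
    (Yi Yj : Corr A) (Tij Tji : Corr A)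
    (mij : Yi.X → Yj.X → Tij.X) (mji : Yj.X → Yi.X → Tji.X)
    (θij : Tij.X → Tji.X)
    (Zi Zj : Corr O) (mmi : Yi.X → O → Zi.X) (mmj : Yj.X → O → Zj.X)
    (TZ TZr : Corr O) (mZ : Zi.X → Zj.X → TZ.X) (mZr : Zj.X → Zi.X → TZr.X)
    (R : TZ.X → TZr.X) : Type (u + 1) where
  Pl : Corr O
  Pr : Corr O
  pij : Yi.X → Zj.X → Pl.X
  pji : Yj.X → Zi.X → Pr.X
  hp : MixedPair Yi πA Zj Pl pij
  hpr : MixedPair Yj πA Zi Pr pji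
  q : Tij.X → O → Pl.X
  qr : Tji.X → O → Pr.X
  hq : MixedMod Tij O πA Pl q
  hqr : MixedMod Tji O πA Pr qr
  q_compat : ∀ x y S, q (mij x y) S = pij x (mmj y S)
  q_compatr : ∀ y x S, qr (mji y x) S = pji y (mmi x S)
  ν : TZ.X → Pl.X
  νr : TZr.X → Pr.X
  hν : IsCLMap ν ∧ Function.Bijective ν ∧
    ∀ x S ζ, ν (mZ (mmi x S) ζ) = pij x (Zj.lactL S ζ)
  hνr : IsCLMap νr ∧ Function.Bijective νr ∧
    ∀ y S ζ, νr (mZr (mmj y S) ζ) = pji y (Zi.lactL S ζ)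
  Θ : Pl.X → Pr.X
  hΘ : IsCLMap Θ ∧ ∀ u S, Θ (q u S) = qr (θij u) S
  hR : ∀ z, νr (R z) = Θ (ν z)

/-! ### Auxiliary facts on Hilbert modules and correspondences -/

section Basics

variable {E F : Type*} [NormedAddCommGroup E] [NormedSpace ℂ E]
  [NormedAddCommGroup F] [NormedSpace ℂ F]

lemma clm_eq_of_total {S : Set E} (hS : closure (Submodule.span ℂ S : Set E) = Set.univ)
    (f g : E →L[ℂ] F) (h : ∀ x ∈ S, f x = g x) (x : E) : f x = g x := by
  have : f = g := ContinuousLinearMap.ext_on (dense_iff_closure_eq.mpr hS) h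
  rw [this]

lemma mem_of_total {S : Set E} (hS : closure (Submodule.span ℂ S : Set E) = Set.univ)
    {K : Submodule ℂ F} (hK : IsClosed (K : Set F)) (f : E →L[ℂ] F) (h : ∀ x ∈ S, f x ∈ K)
    (x : E) : f x ∈ K := by
  have h1 : Submodule.span ℂ S ≤ K.comap (f : E →ₗ[ℂ] F) := Submodule.span_le.mpr h
  have h2 : closure (Submodule.span ℂ S : Set E) ⊆ f ⁻¹' K :=
    closure_minimal h1 (hK.preimage f.continuous)
  exact h2 (hS ▸ Set.mem_univ x)

lemma total_of_forall_mem {S T : Set E}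
    (hT : closure (Submodule.span ℂ T : Set E) = Set.univ)
    (h : ∀ x ∈ T, x ∈ (Submodule.span ℂ S).topologicalClosure) :
    closure (Submodule.span ℂ S : Set E) = Set.univ := by
  refine Set.eq_univ_of_forall fun x => ?_
  exact mem_of_total hT (Submodule.isClosed_topologicalClosure _) (ContinuousLinearMap.id ℂ E) h x

end Basics

namespace IsCLMap

variable {E F : Type u} [NormedAddCommGroup E] [NormedSpace ℂ E]
  [NormedAddCommGroup F] [NormedSpace ℂ F]

/-- The continuous linear map underlying a function satisfying `IsCLMap`. -/
def toCLM {f : E → F} (h : IsCLMap f) : E →L[ℂ] F where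
  toFun := f
  map_add' := h.map_add
  map_smul' := h.map_smul
  cont := h.cont

@[simp] lemma toCLM_apply {f : E → F} (h : IsCLMap f) (x : E) : h.toCLM x = f x := rfl

lemma of_clm (f : E →L[ℂ] F) : IsCLMap f := ⟨f.map_add, f.map_smul, f.continuous⟩

end IsCLMap

namespace Corr

variable (W : Corr A)

lemma inner_zero_right (x : W.X) : W.inner x 0 = 0 := by
  simpa using W.inner_smul_right 0 x 0

lemma inner_add_left (x y z : W.X) : W.inner (x + y) z = W.inner x z + W.inner y z := by
  rw [← W.inner_star, W.inner_add_right, star_add, W.inner_star, W.inner_star]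

lemma inner_smul_left (c : ℂ) (x y : W.X) : W.inner (c • x) y = star c • W.inner x y := by
  rw [← W.inner_star, W.inner_smul_right, star_smul, W.inner_star]

lemma inner_ract_left (x y : W.X) (a : A) : W.inner (W.ract x a) y = star a * W.inner x y := by
  rw [← W.inner_star, W.inner_ract_right, star_mul, W.inner_star]

lemma norm_inner_le (x y : W.X) : ‖W.inner x y‖ ≤ 6 * ‖x‖ * ‖y‖ := by
  have crude (x y : W.X) (hx : ‖x‖ ≤ 1) (hy : ‖y‖ ≤ 1) : ‖W.inner x y + W.inner y x‖ ≤ 6 := by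
    have h : W.inner x y + W.inner y x =
        W.inner (x + y) (x + y) - W.inner x x - W.inner y y := by
      simp only [W.inner_add_right, W.inner_add_left]; abel
    rw [h]
    have h1 := norm_sub_le (W.inner (x + y) (x + y) - W.inner x x) (W.inner y y)
    have h2 := norm_sub_le (W.inner (x + y) (x + y)) (W.inner x x)
    rw [← W.norm_eq, ← W.norm_eq] at h2
    rw [← W.norm_eq y] at h1
    have h3 := norm_add_le x y
    nlinarith [norm_nonneg x, norm_nonneg y, norm_nonneg (x + y)]
  have unit_bound (x y : W.X) (hx : ‖x‖ ≤ 1) (hy : ‖y‖ ≤ 1) : ‖W.inner x y‖ ≤ 6 := by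
    have h1 := crude x y hx hy
    have h2 := crude x (Complex.I • y) hx (by simpa [norm_smul] using hy)
    rw [W.inner_smul_right, W.inner_smul_left] at h2
    have h : (2 : ℂ) • W.inner x y = (W.inner x y + W.inner y x) +
        (-Complex.I) • (Complex.I • W.inner x y + star Complex.I • W.inner y x) := by
      simp only [smul_add, smul_smul]
      simp [two_smul]
      abel
    have h4 := norm_add_le (W.inner x y + W.inner y x)
      ((-Complex.I) • (Complex.I • W.inner x y + star Complex.I • W.inner y x))
    rw [← h, norm_smul, norm_smul, norm_neg, Complex.norm_I] at h4
    norm_num at h4 h2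
    linarith
  have normalize (x : W.X) (hx : x ≠ 0) : ‖((‖x‖⁻¹ : ℝ) : ℂ) • x‖ ≤ 1 := by
    rw [norm_smul, Complex.norm_real, norm_inv, norm_norm,
      inv_mul_cancel₀ (norm_ne_zero_iff.mpr hx)]
  by_cases hx : x = 0
  · subst hx
    rw [← W.inner_star, W.inner_zero_right]; simp
  by_cases hy : y = 0
  · subst hy
    rw [W.inner_zero_right]; simp
  have h := unit_bound _ _ (normalize x hx) (normalize y hy)
  rw [W.inner_smul_right, W.inner_smul_left, norm_smul, norm_smul, norm_star, Complex.norm_real,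
    Complex.norm_real, norm_inv, norm_inv, norm_norm, norm_norm] at h
  have hx' := norm_pos_iff.mpr hx
  have hy' := norm_pos_iff.mpr hy
  have h5 : ‖y‖⁻¹ * (‖x‖⁻¹ * ‖W.inner x y‖) = ‖W.inner x y‖ / (‖x‖ * ‖y‖) := by
    field_simp
  rw [h5, div_le_iff₀ (by positivity)] at h
  linarith

/-- The inner product with a fixed first argument, as a continuous linear map. -/
def innerR (x : W.X) : W.X →L[ℂ] A :=
  LinearMap.mkContinuous
    { toFun := W.inner x
      map_add' := W.inner_add_right x
      map_smul' := fun c y => W.inner_smul_right c x y } (6 * ‖x‖) (W.norm_inner_le x)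

@[simp] lemma innerR_apply (x y : W.X) : W.innerR x y = W.inner x y := rfl

lemma inner_sub_right (x y z : W.X) : W.inner x (y - z) = W.inner x y - W.inner x z :=
  (W.innerR x).map_sub y z

lemma inner_sub_left (x y z : W.X) : W.inner (x - y) z = W.inner x z - W.inner y z := by
  rw [← W.inner_star, W.inner_sub_right, star_sub, W.inner_star, W.inner_star]

lemma eq_zero_of_inner_self {x : W.X} (h : W.inner x x = 0) : x = 0 := by
  have := W.norm_eq x
  rw [h, norm_zero] at this
  simpa using this

lemma eq_of_inner_total {S : Set W.X}
    (hS : closure (Submodule.span ℂ S : Set W.X) = Set.univ) {x y : W.X}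
    (h : ∀ s ∈ S, W.inner s x = W.inner s y) : x = y := by
  rw [← sub_eq_zero]
  apply W.eq_zero_of_inner_self
  refine clm_eq_of_total hS (W.innerR (x - y)) 0 (fun s hs => ?_) (x - y)
  rw [innerR_apply, ← W.inner_star, W.inner_sub_right, h s hs, sub_self, star_zero]
  rfl

lemma eq_of_inner {x y : W.X} (h : ∀ s, W.inner s x = W.inner s y) : x = y :=
  W.eq_of_inner_total (S := Set.univ) (by simp) fun s _ => h s

lemma norm_ract_le (x : W.X) (a : A) : ‖W.ract x a‖ ≤ ‖x‖ * ‖a‖ := by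
  refine le_of_sq_le_sq ?_ (by positivity)
  rw [W.norm_eq, W.inner_ract_right, W.inner_ract_left, mul_pow, W.norm_eq]
  calc ‖star a * W.inner x x * a‖ ≤ ‖star a * W.inner x x‖ * ‖a‖ := norm_mul_le _ _
    _ ≤ ‖star a‖ * ‖W.inner x x‖ * ‖a‖ := by gcongr; exact norm_mul_le _ _
    _ = _ := by rw [norm_star]; ring

/-- The right action of a fixed algebra element, as a continuous linear map. -/
def ractR (a : A) : W.X →L[ℂ] W.X :=
  LinearMap.mkContinuous
    { toFun := fun x => W.ract x a
      map_add' := fun x y => W.ract_add_left x y a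
      map_smul' := fun c x => W.ract_smul c x a } ‖a‖ fun x => by
        rw [mul_comm]; exact W.norm_ract_le x a

@[simp] lemma ractR_apply (a : A) (x : W.X) : W.ractR a x = W.ract x a := rfl

lemma ract_lact (a b : A) (x : W.X) : W.ract (W.lactL a x) b = W.lactL a (W.ract x b) := by
  refine W.eq_of_inner fun s => ?_
  have h (y : W.X) : W.inner s (W.lactL a y) = W.inner (W.lactL (star a) s) y := by
    rw [W.lact_adjoint, star_star]
  rw [W.inner_ract_right, h, h, W.inner_ract_right]

lemma inner_lact_right (a : A) (x y : W.X) :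
    W.inner x (W.lactL a y) = W.inner (W.lactL (star a) x) y := by
  rw [W.lact_adjoint, star_star]

lemma eq_of_ract {x y : W.X} (h : ∀ a, W.ract x a = W.ract y a) : x = y := by
  rw [← sub_eq_zero]
  apply W.eq_zero_of_inner_self
  have h1 : W.ract (x - y) (star (W.inner (x - y) (x - y))) = 0 := by
    have := (W.ractR (star (W.inner (x - y) (x - y)))).map_sub x y
    simp only [ractR_apply] at this
    rw [this, h, sub_self]
  have h2 := W.inner_ract_right (x - y) (x - y) (star (W.inner (x - y) (x - y)))
  rw [h1, W.inner_zero_right] at h2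
  exact CStarRing.mul_star_self_eq_zero_iff _ |>.mp h2.symm

/-- The left action extended to the unitization. -/
def unitAct (w : Unitization ℂ A) (x : W.X) : W.X := w.fst • x + W.lactL w.snd x

lemma lact_zero : W.lactL 0 = 0 := by simpa using W.lact_smul 0 0

lemma inner_unitAct (w : Unitization ℂ A) (x y : W.X) :
    W.inner (W.unitAct w x) (W.unitAct w y) = W.inner x (W.unitAct (star w * w) y) := by
  simp only [unitAct, W.inner_add_left, W.inner_add_right, W.inner_smul_left, W.inner_smul_right,
    W.lact_adjoint, W.lact_add, W.lact_mul, W.lact_smul, Unitization.fst_mul, Unitization.snd_mul,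
    Unitization.fst_star, Unitization.snd_star, add_apply,
    smul_apply, ContinuousLinearMap.comp_apply, smul_smul]
  abel

lemma norm_unitAct_of_unitary (w : unitary (Unitization ℂ A)) (x : W.X) :
    ‖W.unitAct w x‖ = ‖x‖ := by
  have h : ‖W.unitAct w x‖ ^ 2 = ‖x‖ ^ 2 := by
    rw [W.norm_eq, W.norm_eq, W.inner_unitAct, Unitary.coe_star_mul_self]
    simp [unitAct, W.lact_zero]
  exact (sq_eq_sq₀ (norm_nonneg _) (norm_nonneg _)).mp h

lemma norm_lact_le (a : A) (x : W.X) : ‖W.lactL a x‖ ≤ 2 * ‖x‖ * ‖a‖ := by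
  obtain ⟨u, c, h, hc⟩ := CStarAlgebra.exists_sum_four_unitary (a : Unitization ℂ A)
  have hsum : W.lactL a x = ∑ i, c i • W.unitAct (u i) x := by
    have h1 := congrArg (fun w => W.unitAct w x) h
    have h2 : W.unitAct (a : Unitization ℂ A) x = W.lactL a x := by simp [unitAct]
    simp only [h2] at h1
    rw [h1]
    simp only [Fin.sum_univ_four, unitAct, Unitization.fst_add, Unitization.snd_add,
      Unitization.fst_smul, Unitization.snd_smul, W.lact_add, W.lact_smul,
      add_apply, smul_apply, smul_add, add_smul,
      smul_eq_mul, smul_smul]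
    abel
  rw [hsum]
  refine (norm_sum_le _ _).trans ?_
  calc ∑ i, ‖c i • W.unitAct (u i) x‖ ≤ ∑ _i : Fin 4, ‖a‖ / 2 * ‖x‖ := by
        refine Finset.sum_le_sum fun i _ => ?_
        rw [norm_smul, norm_unitAct_of_unitary]
        gcongr
        simpa [Unitization.norm_inr] using hc i
    _ = 2 * ‖x‖ * ‖a‖ := by simp; ring

/-- The left action on a fixed vector, as a continuous linear map. -/
def lactR (x : W.X) : A →L[ℂ] W.X :=
  LinearMap.mkContinuous
    { toFun := fun a => W.lactL a x
      map_add' := fun a b => by rw [W.lact_add]; rfl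
      map_smul' := fun c a => by rw [W.lact_smul]; rfl } (2 * ‖x‖) fun a => W.norm_lact_le a x

lemma ract_total :
    closure (Submodule.span ℂ {y : W.X | ∃ x a, y = W.ract x a} : Set W.X) = Set.univ := by
  let _ := CStarAlgebra.spectralOrder A
  let _ := CStarAlgebra.spectralOrderedRing A
  refine Set.eq_univ_of_forall fun x => ?_
  have hu := CStarAlgebra.increasingApproximateUnit A
  refine mem_closure_of_tendsto (f := fun e : A => W.ract x e) (b := CStarAlgebra.approximateUnit A)
    ?_ (Eventually.of_forall fun e => Submodule.subset_span ⟨x, e, rfl⟩)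
  rw [tendsto_iff_norm_sub_tendsto_zero]
  have hsq : Tendsto (fun e : A => ‖W.ract x e - x‖ ^ 2) (CStarAlgebra.approximateUnit A)
      (𝓝 0) := by
    have hb := hu.tendsto_mul_left (W.inner x x)
    have hnn := hu.eventually_nnnorm
    have hsa := hu.eventually_star_eq
    have key : ∀ᶠ e in CStarAlgebra.approximateUnit A,
        ‖W.ract x e - x‖ ^ 2 ≤ 2 * ‖W.inner x x * e - W.inner x x‖ := by
      filter_upwards [hnn, hsa] with e he hse
      have h1 : W.inner (W.ract x e - x) (W.ract x e - x) =
          e * (W.inner x x * e - W.inner x x) - (W.inner x x * e - W.inner x x) := by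
        simp only [W.inner_sub_left, W.inner_sub_right, W.inner_ract_left, W.inner_ract_right, hse,
          mul_sub]
      rw [W.norm_eq, h1]
      have he' : ‖e‖ ≤ 1 := by exact_mod_cast he
      refine (norm_sub_le _ _).trans ?_
      have := norm_mul_le e (W.inner x x * e - W.inner x x)
      nlinarith [norm_nonneg (W.inner x x * e - W.inner x x)]
    have h0 : Tendsto (fun e : A => 2 * ‖W.inner x x * e - W.inner x x‖)
        (CStarAlgebra.approximateUnit A) (𝓝 0) := by
      have := (tendsto_iff_norm_sub_tendsto_zero.mp hb).const_mul 2
      simpa using this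
    exact tendsto_of_tendsto_of_tendsto_of_le_of_le' tendsto_const_nhds h0
      (Eventually.of_forall fun e => by positivity) key
  have := hsq.sqrt
  simpa [Real.sqrt_sq] using this

end Corr

/-! ### Maps compatible with inner products along a homomorphism of coefficient algebras -/

/-- A continuous linear map from a correspondence over `A` to a correspondence over `B` which
intertwines inner products and left actions along `π : A →⋆ₙₐ[ℂ] B`. -/
structure Emb (π : A →⋆ₙₐ[ℂ] B) (W : Corr A) (Z : Corr B) (f : W.X →L[ℂ] Z.X) : Prop where
  inner : ∀ x y, Z.inner (f x) (f y) = π (W.inner x y)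
  lact : ∀ a x, Z.lactL (π a) (f x) = f (W.lactL a x)

lemma map_ract_of_inner {π : A →⋆ₙₐ[ℂ] B} {W : Corr A} {Z : Corr B} {f : W.X →L[ℂ] Z.X}
    (h : ∀ x y, Z.inner (f x) (f y) = π (W.inner x y)) (x : W.X) (a : A) :
    f (W.ract x a) = Z.ract (f x) (π a) := by
  rw [← sub_eq_zero]
  apply Z.eq_zero_of_inner_self
  simp only [Z.inner_sub_left, Z.inner_sub_right, Z.inner_ract_left, Z.inner_ract_right, h,
    W.inner_ract_left, W.inner_ract_right, map_mul, map_star, mul_assoc]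
  abel

lemma norm_map_of_inner {π : A →⋆ₙₐ[ℂ] B} (hπ : Function.Injective π) {W : Corr A} {Z : Corr B}
    {f : W.X →L[ℂ] Z.X} (h : ∀ x y, Z.inner (f x) (f y) = π (W.inner x y)) (x : W.X) :
    ‖f x‖ = ‖x‖ := by
  refine (sq_eq_sq₀ (norm_nonneg _) (norm_nonneg _)).mp ?_
  rw [Z.norm_eq, W.norm_eq, h, NonUnitalStarAlgHom.norm_map π hπ]

lemma inner_linearCombination {π : A →⋆ₙₐ[ℂ] B} {W : Corr A} {Z : Corr B} {ι : Type*}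
    {s : ι → W.X} {t : ι → Z.X} (h : ∀ i j, Z.inner (t i) (t j) = π (W.inner (s i) (s j)))
    (c d : ι →₀ ℂ) :
    Z.inner (Finsupp.linearCombination ℂ t c) (Finsupp.linearCombination ℂ t d) =
      π (W.inner (Finsupp.linearCombination ℂ s c) (Finsupp.linearCombination ℂ s d)) := by
  induction d using Finsupp.induction_linear with
  | zero => simp [Corr.inner_zero_right]
  | add d d' hd hd' => simp only [map_add, Corr.inner_add_right, hd, hd']
  | single j b =>
    simp only [Finsupp.linearCombination_single, Corr.inner_smul_right, map_smul]
    congr 1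
    induction c using Finsupp.induction_linear with
    | zero =>
      simp only [map_zero]
      rw [← Z.inner_star, ← W.inner_star, Z.inner_zero_right, W.inner_zero_right]
      simp
    | add c c' hc hc' => simp only [map_add, Corr.inner_add_left, hc, hc']
    | single i b => simp only [Finsupp.linearCombination_single, Corr.inner_smul_left, map_smul, h]

/-- A family with total range can be mapped isometrically onto any family with the same Gram
matrix. -/
lemma exists_map_of_inner (π : A →⋆ₙₐ[ℂ] B) {W : Corr A} {Z : Corr B} {ι : Type*}
    (s : ι → W.X) (t : ι → Z.X)
    (hs : closure (Submodule.span ℂ (Set.range s) : Set W.X) = Set.univ)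
    (h : ∀ i j, Z.inner (t i) (t j) = π (W.inner (s i) (s j))) :
    ∃ f : W.X →L[ℂ] Z.X, (∀ i, f (s i) = t i) ∧
      ∀ x y, Z.inner (f x) (f y) = π (W.inner x y) := by
  have hdense : DenseRange (Finsupp.linearCombination ℂ s) := by
    have : Set.range (Finsupp.linearCombination ℂ s) = Submodule.span ℂ (Set.range s) := by
      rw [← Finsupp.range_linearCombination]; rfl
    rw [DenseRange, this, dense_iff_closure_eq, hs]
  have hnorm : ∃ C, ∀ c, ‖Finsupp.linearCombination ℂ t c‖ ≤
      C * ‖Finsupp.linearCombination ℂ s c‖ := by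
    refine ⟨1, fun c => ?_⟩
    rw [one_mul]
    refine le_of_sq_le_sq ?_ (norm_nonneg _)
    rw [Z.norm_eq, W.norm_eq, inner_linearCombination h]
    exact NonUnitalStarAlgHom.norm_apply_le π _
  obtain ⟨f, hf⟩ : ∃ f : W.X →L[ℂ] Z.X, ∀ c,
      f (Finsupp.linearCombination ℂ s c) = Finsupp.linearCombination ℂ t c :=
    ⟨_, LinearMap.extendOfNorm_eq hdense hnorm⟩
  have hfs (i) : f (s i) = t i := by simpa using hf (Finsupp.single i 1)
  refine ⟨f, hfs, fun x y => ?_⟩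
  have hπ : Continuous π := AddMonoidHomClass.continuous_of_bound π 1 fun a => by
    rw [one_mul]; exact NonUnitalStarAlgHom.norm_apply_le π a
  let Φ : A →L[ℂ] B := ⟨(π : A →ₗ[ℂ] B), hπ⟩
  have right (i : ι) (y : W.X) : Z.inner (t i) (f y) = π (W.inner (s i) y) := by
    refine clm_eq_of_total hs ((Z.innerR (t i)).comp f) (Φ.comp (W.innerR (s i))) ?_ y
    rintro _ ⟨j, rfl⟩
    change Z.inner (t i) (f (s j)) = π (W.inner (s i) (s j))
    rw [hfs, h]
  have left (y : W.X) : Z.inner (f y) (f x) = π (W.inner y x) := by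
    rw [← Z.inner_star, ← W.inner_star, map_star]
    congr 1
    refine clm_eq_of_total hs ((Z.innerR (f x)).comp f) (Φ.comp (W.innerR x)) ?_ y
    rintro _ ⟨j, rfl⟩
    change Z.inner (f x) (f (s j)) = π (W.inner x (s j))
    rw [hfs, ← Z.inner_star, right, ← map_star, W.inner_star]
  rw [← Z.inner_star, ← W.inner_star, map_star]
  congr 1
  have := left y
  exact this

/-- A pairing of two correspondences over `A` with values in a correspondence over `B`, having the
inner products of an interior tensor product, along `π : A →⋆ₙₐ[ℂ] B`. -/
structure PreTensor (π : A →⋆ₙₐ[ℂ] B) (W V : Corr A) (P : Corr B) (p : W.X → V.X → P.X) :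
    Prop where
  inner : ∀ x y x' y',
    P.inner (p x y) (p x' y') = π (V.inner y (V.lactL (W.inner x x') y'))
  lact : ∀ a x y, P.lactL (π a) (p x y) = p (W.lactL a x) y

namespace PreTensor

variable {π : A →⋆ₙₐ[ℂ] B} {W V : Corr A} {P : Corr B} {p : W.X → V.X → P.X}

lemma add_right (hp : PreTensor π W V P p) (x : W.X) (y y' : V.X) :
    p x (y + y') = p x y + p x y' := by
  rw [← sub_eq_zero]
  apply P.eq_zero_of_inner_self
  simp only [P.inner_sub_left, P.inner_sub_right, P.inner_add_left, P.inner_add_right, hp.inner,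
    map_add, V.inner_add_left, V.inner_add_right]
  abel

lemma add_left (hp : PreTensor π W V P p) (x x' : W.X) (y : V.X) :
    p (x + x') y = p x y + p x' y := by
  rw [← sub_eq_zero]
  apply P.eq_zero_of_inner_self
  simp only [P.inner_sub_left, P.inner_sub_right, P.inner_add_left, P.inner_add_right, hp.inner,
    map_add, V.inner_add_right, W.inner_add_left, W.inner_add_right, V.lact_add, add_apply]
  abel

lemma smul_right (hp : PreTensor π W V P p) (c : ℂ) (x : W.X) (y : V.X) :
    p x (c • y) = c • p x y := by
  rw [← sub_eq_zero]
  apply P.eq_zero_of_inner_self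
  simp only [P.inner_sub_left, P.inner_sub_right, P.inner_smul_left, P.inner_smul_right, hp.inner,
    map_smul, V.inner_smul_left, V.inner_smul_right]
  simp only [smul_comm c (star c)]
  abel

lemma smul_left (hp : PreTensor π W V P p) (c : ℂ) (x : W.X) (y : V.X) :
    p (c • x) y = c • p x y := by
  rw [← sub_eq_zero]
  apply P.eq_zero_of_inner_self
  simp only [P.inner_sub_left, P.inner_sub_right, P.inner_smul_left, P.inner_smul_right, hp.inner,
    map_smul, V.inner_smul_right, W.inner_smul_left, W.inner_smul_right, V.lact_smul, smul_apply]
  simp only [smul_comm c (star c)]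
  abel

lemma balanced (hp : PreTensor π W V P p) (x : W.X) (a : A) (y : V.X) :
    p (W.ract x a) y = p x (V.lactL a y) := by
  rw [← sub_eq_zero]
  apply P.eq_zero_of_inner_self
  simp only [P.inner_sub_left, P.inner_sub_right, hp.inner, W.inner_ract_left, W.inner_ract_right,
    V.lact_mul, V.lact_adjoint, ContinuousLinearMap.comp_apply]
  abel

lemma ract (hp : PreTensor π W V P p) (x : W.X) (y : V.X) (a : A) :
    P.ract (p x y) (π a) = p x (V.ract y a) := by
  rw [← sub_eq_zero]
  apply P.eq_zero_of_inner_self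
  simp only [P.inner_sub_left, P.inner_sub_right, hp.inner, P.inner_ract_left, P.inner_ract_right,
    V.inner_ract_left, V.inner_ract_right, ← V.ract_lact, map_mul, map_star, mul_assoc]
  abel

lemma norm_le (hp : PreTensor π W V P p) (x : W.X) (y : V.X) : ‖p x y‖ ≤ 4 * ‖x‖ * ‖y‖ := by
  refine le_of_sq_le_sq ?_ (by positivity)
  rw [P.norm_eq, hp.inner]
  have h1 := V.norm_inner_le y (V.lactL (W.inner x x) y)
  have h2 := V.norm_lact_le (W.inner x x) y
  rw [← W.norm_eq] at h2
  calc _ ≤ ‖V.inner y (V.lactL (W.inner x x) y)‖ := NonUnitalStarAlgHom.norm_apply_le π _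
    _ ≤ 6 * ‖y‖ * (2 * ‖y‖ * ‖x‖ ^ 2) := h1.trans (by gcongr)
    _ ≤ _ := by nlinarith [mul_nonneg (sq_nonneg ‖x‖) (sq_nonneg ‖y‖)]

/-- A pairing with a fixed first argument, as a continuous linear map. -/
def mulL (hp : PreTensor π W V P p) (x : W.X) : V.X →L[ℂ] P.X :=
  LinearMap.mkContinuous
    { toFun := p x
      map_add' := hp.add_right x
      map_smul' := fun c y => hp.smul_right c x y } (4 * ‖x‖) (hp.norm_le x)

/-- A pairing with a fixed second argument, as a continuous linear map. -/
def mulR (hp : PreTensor π W V P p) (y : V.X) : W.X →L[ℂ] P.X :=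
  LinearMap.mkContinuous
    { toFun := fun x => p x y
      map_add' := fun x x' => hp.add_left x x' y
      map_smul' := fun c x => hp.smul_left c x y } (4 * ‖y‖) fun x => by
        rw [mul_right_comm]; exact hp.norm_le x y

/-- Values of a pairing lie in a closed subspace as soon as they do on total sets. -/
lemma mem_of_total₂ (hp : PreTensor π W V P p) {S : Set W.X} {S' : Set V.X}
    (hS : closure (Submodule.span ℂ S : Set W.X) = Set.univ)
    (hS' : closure (Submodule.span ℂ S' : Set V.X) = Set.univ)
    {K : Submodule ℂ P.X} (hK : IsClosed (K : Set P.X)) (h : ∀ x ∈ S, ∀ y ∈ S', p x y ∈ K)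
    (x : W.X) (y : V.X) : p x y ∈ K :=
  mem_of_total hS hK (hp.mulR y) (fun x hx => mem_of_total hS' hK (hp.mulL x) (h x hx) y) x

/-- A pairing factors through any realization of the interior tensor product. -/
lemma exists_emb (hp : PreTensor π W V P p) {T : Corr A} {m : W.X → V.X → T.X}
    (ht : IsTensor W V T m) :
    ∃ J : T.X →L[ℂ] P.X, Emb π T P J ∧ ∀ x y, J (m x y) = p x y := by
  have hr : Set.range (fun i : W.X × V.X => m i.1 i.2) = {z | ∃ x y, z = m x y} := by
    ext z; simp [eq_comm]
  obtain ⟨J, hJ, hJi⟩ := exists_map_of_inner π (fun i : W.X × V.X => m i.1 i.2)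
    (fun i : W.X × V.X => p i.1 i.2) (by rw [hr]; exact ht.dense)
    fun i j => by simp only [hp.inner, ht.inner]
  have hJ' (x y) : J (m x y) = p x y := hJ (x, y)
  refine ⟨J, ⟨hJi, fun a u => ?_⟩, hJ'⟩
  refine clm_eq_of_total ht.dense ((P.lactL (π a)).comp J) (J.comp (T.lactL a)) ?_ u
  rintro _ ⟨x, y, rfl⟩
  simp only [ContinuousLinearMap.comp_apply, hJ', hp.lact, ht.lact]

end PreTensor

namespace IsTensor

variable {W V T : Corr A} {m : W.X → V.X → T.X}

lemma preTensor (ht : IsTensor W V T m) : PreTensor (NonUnitalStarAlgHom.id ℂ A) W V T m :=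
  ⟨ht.inner, ht.lact⟩

lemma total_of_total (ht : IsTensor W V T m) {S : Set W.X} {S' : Set V.X}
    (hS : closure (Submodule.span ℂ S : Set W.X) = Set.univ)
    (hS' : closure (Submodule.span ℂ S' : Set V.X) = Set.univ) :
    closure (Submodule.span ℂ {z : T.X | ∃ x ∈ S, ∃ y ∈ S', z = m x y} : Set T.X) =
      Set.univ := by
  refine total_of_forall_mem ht.dense ?_
  rintro _ ⟨x, y, rfl⟩
  exact ht.preTensor.mem_of_total₂ hS hS'
    (K := (Submodule.span ℂ {z : T.X | ∃ x ∈ S, ∃ y ∈ S', z = m x y}).topologicalClosure)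
    (Submodule.isClosed_topologicalClosure _) (fun x hx y hy => subset_closure (Submodule.subset_span ⟨x, hx, y, hy, rfl⟩)) x y

/-- A map preserving inner products of the first factor induces a map of tensor products. -/
lemma exists_map_left {W' V T' : Corr A} {m' : W'.X → V.X → T'.X} {m : W.X → V.X → T.X}
    (ht : IsTensor W V T m) (ht' : IsTensor W' V T' m') (f : W.X → W'.X)
    (hf : ∀ x y, W'.inner (f x) (f y) = W.inner x y) :
    ∃ F : T.X →L[ℂ] T'.X, ∀ x y, F (m x y) = m' (f x) y := by
  have hr : Set.range (fun i : W.X × V.X => m i.1 i.2) = {z | ∃ x y, z = m x y} := by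
    ext z; simp [eq_comm]
  obtain ⟨F, hF, -⟩ := exists_map_of_inner (NonUnitalStarAlgHom.id ℂ A)
    (fun i : W.X × V.X => m i.1 i.2) (fun i : W.X × V.X => m' (f i.1) i.2)
    (by rw [hr]; exact ht.dense) fun i j => by simp [ht.inner, ht'.inner, hf]
  exact ⟨F, fun x y => hF (x, y)⟩

/-- An isomorphism of the second factor induces a map of tensor products. -/
lemma exists_map_right {V' T' : Corr A} {m' : W.X → V'.X → T'.X}
    (ht : IsTensor W V T m) (ht' : IsTensor W V' T' m') (f : CorrIso V V') :
    ∃ F : T.X →L[ℂ] T'.X, ∀ x y, F (m x y) = m' x (f.toFun y) := by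
  have hr : Set.range (fun i : W.X × V.X => m i.1 i.2) = {z | ∃ x y, z = m x y} := by
    ext z; simp [eq_comm]
  obtain ⟨F, hF, -⟩ := exists_map_of_inner (NonUnitalStarAlgHom.id ℂ A)
    (fun i : W.X × V.X => m i.1 i.2) (fun i : W.X × V.X => m' i.1 (f.toFun i.2))
    (by rw [hr]; exact ht.dense)
    fun i j => by simp [ht.inner, ht'.inner, ← f.map_lact, f.map_inner]
  exact ⟨F, fun x y => hF (x, y)⟩

/-- The tensor product of two embeddings is a pairing over the smaller algebra. -/
lemma preTensor_of_emb {π : A →⋆ₙₐ[ℂ] B} {Z Z' TZ : Corr B} {mZ : Z.X → Z'.X → TZ.X}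
    (ht : IsTensor Z Z' TZ mZ) {f : W.X →L[ℂ] Z.X} {g : V.X →L[ℂ] Z'.X} (hf : Emb π W Z f)
    (hg : Emb π V Z' g) : PreTensor π W V TZ fun x y => mZ (f x) (g y) where
  inner x y x' y' := by rw [ht.inner, hf.inner, hg.lact, hg.inner]
  lact a x y := by rw [ht.lact, hf.lact]

end IsTensor

/-! ### Triple tensor products inside correspondences over a larger algebra -/

/-- A closed subspace of a correspondence over `B` on which inner products take values in the image
of `π : A →⋆ₙₐ[ℂ] B`, regarded as a correspondence over `A`. -/
def Corr.sub (π : A →⋆ₙₐ[ℂ] B) (hπ : Function.Injective π) (Z : Corr B) (S : Submodule ℂ Z.X)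
    (hS : IsClosed (S : Set Z.X)) (hin : ∀ x y : S, ∃ a, π a = Z.inner x y)
    (hl : ∀ a, ∀ x : S, Z.lactL (π a) x ∈ S) (hr : ∀ a, ∀ x : S, Z.ract x (π a) ∈ S) : Corr A where
  X := S
  cmpl := hS.completeSpace_coe
  ract x a := ⟨Z.ract x (π a), hr a x⟩
  inner x y := (hin x y).choose
  lactL a := ((Z.lactL (π a)).comp S.subtypeL).codRestrict S (hl a)
  rankOne x y := ((Z.rankOne x y).comp S.subtypeL).codRestrict S fun z => by
    obtain ⟨a, ha⟩ := hin y z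
    have := hr a x
    rw [ha, ← Z.rankOne_apply] at this
    exact this
  ract_add_left x y a := Subtype.ext (Z.ract_add_left x y _)
  ract_add_right x a b := Subtype.ext (by simp [Z.ract_add_right])
  ract_mul x a b := Subtype.ext (by simp [Z.ract_mul])
  ract_smul c x a := Subtype.ext (Z.ract_smul c x _)
  ract_smul' c x a := Subtype.ext (by simp [Z.ract_smul'])
  inner_add_right x y z := hπ <| by
    rw [map_add, (hin _ _).choose_spec, (hin _ _).choose_spec, (hin _ _).choose_spec]
    exact Z.inner_add_right _ _ _
  inner_smul_right c x y := hπ <| by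
    rw [map_smul, (hin _ _).choose_spec, (hin _ _).choose_spec]
    exact Z.inner_smul_right _ _ _
  inner_star x y := hπ <| by
    rw [map_star, (hin _ _).choose_spec, (hin _ _).choose_spec, Z.inner_star]
  inner_ract_right x y a := hπ <| by
    rw [map_mul, (hin _ _).choose_spec, (hin _ _).choose_spec]
    exact Z.inner_ract_right _ _ _
  norm_eq x := by
    rw [← NonUnitalStarAlgHom.norm_map π hπ, (hin _ _).choose_spec]
    exact Z.norm_eq x
  lact_add a b := ContinuousLinearMap.ext fun x => Subtype.ext <| by
    change Z.lactL (π (a + b)) x = Z.lactL (π a) x + Z.lactL (π b) x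
    rw [map_add, Z.lact_add]; rfl
  lact_mul a b := ContinuousLinearMap.ext fun x => Subtype.ext <| by
    change Z.lactL (π (a * b)) x = Z.lactL (π a) (Z.lactL (π b) x)
    rw [map_mul, Z.lact_mul]; rfl
  lact_smul c a := ContinuousLinearMap.ext fun x => Subtype.ext <| by
    change Z.lactL (π (c • a)) x = c • Z.lactL (π a) x
    rw [map_smul, Z.lact_smul]; rfl
  lact_adjoint a x y := hπ <| by
    rw [(hin _ _).choose_spec, (hin _ _).choose_spec]
    have := Z.lact_adjoint (π a) x y
    rw [← map_star] at this
    exact this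
  rankOne_apply x y z := Subtype.ext <| by
    change Z.rankOne x y z = Z.ract x (π (hin y z).choose)
    rw [(hin y z).choose_spec, Z.rankOne_apply]

/-- The total span of a pairing is a correspondence over the smaller algebra. -/
lemma PreTensor.exists_corr {π : A →⋆ₙₐ[ℂ] B} (hπ : Function.Injective π) {W V : Corr A}
    {P : Corr B} {p : W.X → V.X → P.X} (hp : PreTensor π W V P p) :
    ∃ (Q : Corr A) (ι : Q.X →L[ℂ] P.X), Emb π Q P ι ∧ Function.Injective ι ∧
      Set.range ι = closure (Submodule.span ℂ {z : P.X | ∃ x y, z = p x y} : Set P.X) := by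
  set S := (Submodule.span ℂ {z : P.X | ∃ x y, z = p x y}).topologicalClosure with hSdef
  have hS : IsClosed (S : Set P.X) := Submodule.isClosed_topologicalClosure _
  have hpS (x y) : p x y ∈ S := subset_closure (Submodule.subset_span ⟨x, y, rfl⟩)
  have induct {K : Submodule ℂ P.X} (hK : IsClosed (K : Set P.X))
      (h : ∀ x y, p x y ∈ K) : S ≤ K := by
    refine Submodule.topologicalClosure_minimal _ (Submodule.span_le.mpr ?_) hK
    rintro _ ⟨x, y, rfl⟩
    exact h x y
  have map_mem (f : P.X →L[ℂ] P.X) (h : ∀ x y, f (p x y) ∈ S) (x : S) : f x ∈ S :=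
    induct (K := S.comap (f : P.X →ₗ[ℂ] P.X)) (hS.preimage f.continuous) h x.2
  let ρ : Submodule ℂ B := LinearMap.range (π : A →ₗ[ℂ] B)
  have hρ : IsClosed (ρ : Set B) := by
    have := (NonUnitalStarAlgHom.isometry π hπ).isClosedEmbedding.isClosed_range
    exact this
  have hstar (b : B) (hb : b ∈ ρ) : star b ∈ ρ := by
    obtain ⟨a, rfl⟩ := hb
    exact ⟨star a, map_star π a⟩
  have hin (x y : S) : P.inner x y ∈ ρ := by
    refine induct (K := ρ.comap (P.innerR x : P.X →ₗ[ℂ] B))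
      (hρ.preimage (P.innerR x).continuous) (fun w v => ?_) y.2
    change P.inner x (p w v) ∈ ρ
    rw [← P.inner_star]
    refine hstar _ (induct (K := ρ.comap (P.innerR (p w v) : P.X →ₗ[ℂ] B))
      (hρ.preimage (P.innerR (p w v)).continuous) (fun w' v' => ?_) x.2)
    exact ⟨_, (hp.inner _ _ _ _).symm⟩
  have hl (a : A) (x : S) : P.lactL (π a) x ∈ S :=
    map_mem (P.lactL (π a)) (fun x y => by rw [hp.lact]; exact hpS _ _) x
  have hr (a : A) (x : S) : P.ract x (π a) ∈ S :=
    map_mem (P.ractR (π a)) (fun x y => by rw [Corr.ractR_apply, hp.ract]; exact hpS _ _) x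
  refine ⟨Corr.sub π hπ P S hS hin hl hr, S.subtypeL,
    ⟨fun x y => (hin x y).choose_spec.symm, fun a x => rfl⟩, Subtype.val_injective, ?_⟩
  exact Subtype.range_coe

/-- An embedded correspondence spanned by a pairing realizes the interior tensor product. -/
lemma PreTensor.isTensor_of_emb {π : A →⋆ₙₐ[ℂ] B} (hπ : Function.Injective π) {W V Q : Corr A}
    {P : Corr B} {p : W.X → V.X → P.X} (hp : PreTensor π W V P p) {ι : Q.X →L[ℂ] P.X}
    (hι : Emb π Q P ι) (hr : Set.range ι ⊆ closure (Submodule.span ℂ {z : P.X | ∃ x y, z = p x y}))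
    {m : W.X → V.X → Q.X} (hm : ∀ x y, ι (m x y) = p x y) : IsTensor W V Q m := by
  have hiso : Isometry ι := AddMonoidHomClass.isometry_of_norm ι (norm_map_of_inner hπ hι.inner)
  have hpre : PreTensor (NonUnitalStarAlgHom.id ℂ A) W V Q m := by
    refine ⟨fun x y x' y' => hπ ?_, fun a x y => hiso.injective ?_⟩
    · rw [← hι.inner, hm, hm, hp.inner]; rfl
    · rw [NonUnitalStarAlgHom.coe_id, id, ← hι.lact, hm, hm, hp.lact]
  refine ⟨hpre.add_left, hpre.add_right, hpre.smul_left, hpre.smul_right, hpre.balanced,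
    hpre.inner, hpre.ract, hpre.lact, Set.eq_univ_of_forall fun w => ?_⟩
  have himg : (Submodule.span ℂ {z : P.X | ∃ x y, z = p x y} : Set P.X) =
      ι '' (Submodule.span ℂ {z : Q.X | ∃ x y, z = m x y} : Set Q.X) := by
    have : {z : P.X | ∃ x y, z = p x y} = ι '' {z : Q.X | ∃ x y, z = m x y} := by
      ext z
      constructor
      · rintro ⟨x, y, rfl⟩; exact ⟨_, ⟨x, y, rfl⟩, hm x y⟩
      · rintro ⟨_, ⟨x, y, rfl⟩, rfl⟩; exact ⟨x, y, hm x y⟩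
    rw [this]
    exact congrArg SetLike.coe (Submodule.map_span (ι : Q.X →ₗ[ℂ] P.X) _).symm
  have hw := hr ⟨w, rfl⟩
  rw [himg] at hw
  rwa [hiso.isEmbedding.isInducing.closure_eq_preimage_closure_image]

/-- A triple tensor product of correspondences over `A`, realized inside a correspondence over
`B` along `π : A →⋆ₙₐ[ℂ] B`, with its two bracketings. -/
structure ETrip (π : A →⋆ₙₐ[ℂ] B) (W₁ W₂ W₃ T₁₂ : Corr A) (m₁₂ : W₁.X → W₂.X → T₁₂.X)
    (T₂₃ : Corr A) (m₂₃ : W₂.X → W₃.X → T₂₃.X) (P : Corr B) (lp : T₁₂.X → W₃.X → P.X)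
    (rp : W₁.X → T₂₃.X → P.X) : Prop where
  lt : PreTensor π T₁₂ W₃ P lp
  rt : PreTensor π W₁ T₂₃ P rp
  compat : ∀ x y z, lp (m₁₂ x y) z = rp x (m₂₃ y z)

lemma ETrip.exists_trip {π : A →⋆ₙₐ[ℂ] B} (hπ : Function.Injective π) {W₁ W₂ W₃ T₁₂ : Corr A}
    {m₁₂ : W₁.X → W₂.X → T₁₂.X} {T₂₃ : Corr A} {m₂₃ : W₂.X → W₃.X → T₂₃.X} {P : Corr B}
    {lp : T₁₂.X → W₃.X → P.X} {rp : W₁.X → T₂₃.X → P.X}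
    (h : ETrip π W₁ W₂ W₃ T₁₂ m₁₂ T₂₃ m₂₃ P lp rp) (h₁₂ : IsTensor W₁ W₂ T₁₂ m₁₂)
    (h₂₃ : IsTensor W₂ W₃ T₂₃ m₂₃) :
    ∃ (Q : Corr A) (R : Trip W₁ W₂ W₃ T₁₂ m₁₂ T₂₃ m₂₃ Q) (ι : Q.X →L[ℂ] P.X),
      (∀ u z, ι (R.lp u z) = lp u z) ∧ ∀ x v, ι (R.rp x v) = rp x v := by
  have hle : closure (Submodule.span ℂ {z : P.X | ∃ x v, z = rp x v} : Set P.X) =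
      closure (Submodule.span ℂ {w : P.X | ∃ u z, w = lp u z} : Set P.X) := by
    refine subset_antisymm ?_ ?_
    · refine closure_minimal ?_ isClosed_closure
      refine (Submodule.span_le (p := (Submodule.span ℂ
        {w : P.X | ∃ u z, w = lp u z}).topologicalClosure)).mpr ?_
      rintro _ ⟨x, v, rfl⟩
      refine mem_of_total h₂₃.dense (Submodule.isClosed_topologicalClosure _) (h.rt.mulL x) ?_ v
      rintro _ ⟨y, z, rfl⟩
      exact subset_closure (Submodule.subset_span ⟨m₁₂ x y, z, (h.compat x y z).symm⟩)
    · refine closure_minimal ?_ isClosed_closure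
      refine (Submodule.span_le (p := (Submodule.span ℂ
        {w : P.X | ∃ x v, w = rp x v}).topologicalClosure)).mpr ?_
      rintro _ ⟨u, z, rfl⟩
      refine mem_of_total h₁₂.dense (Submodule.isClosed_topologicalClosure _) (h.lt.mulR z) ?_ u
      rintro _ ⟨x, y, rfl⟩
      exact subset_closure (Submodule.subset_span ⟨x, m₂₃ y z, h.compat x y z⟩)
  obtain ⟨Q, ι, hι, hinj, hrange⟩ := h.lt.exists_corr hπ
  have hlp (u z) : ∃ q, ι q = lp u z := by
    change lp u z ∈ Set.range ι
    rw [hrange]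
    exact subset_closure (Submodule.subset_span ⟨u, z, rfl⟩)
  have hrp (x v) : ∃ q, ι q = rp x v := by
    change rp x v ∈ Set.range ι
    rw [hrange, ← hle]
    exact subset_closure (Submodule.subset_span ⟨x, v, rfl⟩)
  choose l hl using hlp
  choose r hr using hrp
  exact ⟨Q, ⟨l, r, h.lt.isTensor_of_emb hπ hι hrange.subset hl,
    h.rt.isTensor_of_emb hπ hι (hrange.trans hle.symm).subset hr,
    fun x y z => hinj (by rw [hl, hr, h.compat])⟩, ι, hl, hr⟩

/-- The hexagonal relation, transported to realizations over a larger algebra.  The map on the first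
edge of the second path need not be globally defined. -/
lemma HexProp.eq_of_eTrip {π : A →⋆ₙₐ[ℂ] B} (hπ : Function.Injective π)
    {Yi Yj Yl Tij Tji Til Tli Tjl Tlj : Corr A}
    {mij : Yi.X → Yj.X → Tij.X} {mji : Yj.X → Yi.X → Tji.X}
    {mil : Yi.X → Yl.X → Til.X} {mli : Yl.X → Yi.X → Tli.X}
    {mjl : Yj.X → Yl.X → Tjl.X} {mlj : Yl.X → Yj.X → Tlj.X}
    {θij : CorrIso Tij Tji} {θil : CorrIso Til Tli} {θjl : CorrIso Tjl Tlj}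
    (hex : HexProp Yi Yj Yl Tij Tji Til Tli Tjl Tlj mij mji mil mli mjl mlj
      θij.toFun θil.toFun θjl.toFun)
    (hij : IsTensor Yi Yj Tij mij) (hji : IsTensor Yj Yi Tji mji) (hil : IsTensor Yi Yl Til mil)
    (hli : IsTensor Yl Yi Tli mli) (hjl : IsTensor Yj Yl Tjl mjl) (hlj : IsTensor Yl Yj Tlj mlj)
    {P₁ P₂ P₃ P₄ P₅ P₆ : Corr B}
    {l₁ r₁ l₂ r₂ l₃ r₃ l₄ r₄ l₅ r₅ l₆ r₆}
    (E₁ : ETrip π Yi Yj Yl Tij mij Tjl mjl P₁ l₁ r₁)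
    (E₂ : ETrip π Yj Yi Yl Tji mji Til mil P₂ l₂ r₂)
    (E₃ : ETrip π Yj Yl Yi Tjl mjl Tli mli P₃ l₃ r₃)
    (E₄ : ETrip π Yl Yj Yi Tlj mlj Tji mji P₄ l₄ r₄)
    (E₅ : ETrip π Yi Yl Yj Til mil Tlj mlj P₅ l₅ r₅)
    (E₆ : ETrip π Yl Yi Yj Tli mli Tij mij P₆ l₆ r₆)
    (F₁ : P₁.X →L[ℂ] P₂.X) (F₂ : P₂.X →L[ℂ] P₃.X) (F₃ : P₃.X →L[ℂ] P₄.X)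
    (F₅ : P₅.X →L[ℂ] P₆.X) (F₆ : P₆.X →L[ℂ] P₄.X)
    (h₁ : ∀ u z, F₁ (l₁ u z) = l₂ (θij.toFun u) z)
    (h₂ : ∀ y v, F₂ (r₂ y v) = r₃ y (θil.toFun v))
    (h₃ : ∀ u z, F₃ (l₃ u z) = l₄ (θjl.toFun u) z)
    (h₅ : ∀ u z, F₅ (l₅ u z) = l₆ (θil.toFun u) z)
    (h₆ : ∀ x v, F₆ (r₆ x v) = r₄ x (θij.toFun v)) (x : Yi.X) (v : Tjl.X) :
    F₃ (F₂ (F₁ (r₁ x v))) = F₆ (F₅ (r₅ x (θjl.toFun v))) := by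
  obtain ⟨Q₁, R₁, ι₁, hl₁, hr₁⟩ := E₁.exists_trip hπ hij hjl
  obtain ⟨Q₂, R₂, ι₂, hl₂, hr₂⟩ := E₂.exists_trip hπ hji hil
  obtain ⟨Q₃, R₃, ι₃, hl₃, hr₃⟩ := E₃.exists_trip hπ hjl hli
  obtain ⟨Q₄, R₄, ι₄, hl₄, hr₄⟩ := E₄.exists_trip hπ hlj hji
  obtain ⟨Q₅, R₅, ι₅, hl₅, hr₅⟩ := E₅.exists_trip hπ hil hlj
  obtain ⟨Q₆, R₆, ι₆, hl₆, hr₆⟩ := E₆.exists_trip hπ hli hij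
  obtain ⟨G₁, hG₁⟩ := R₁.lt.exists_map_left R₂.lt _ θij.map_inner
  obtain ⟨G₂, hG₂⟩ := R₂.rt.exists_map_right R₃.rt θil
  obtain ⟨G₃, hG₃⟩ := R₃.lt.exists_map_left R₄.lt _ θjl.map_inner
  obtain ⟨G₄, hG₄⟩ := R₁.rt.exists_map_right R₅.rt θjl
  obtain ⟨G₅, hG₅⟩ := R₅.lt.exists_map_left R₆.lt _ θil.map_inner
  obtain ⟨G₆, hG₆⟩ := R₆.rt.exists_map_right R₄.rt θij
  have c₁ (w) : F₁ (ι₁ w) = ι₂ (G₁ w) := by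
    refine clm_eq_of_total R₁.lt.dense (F₁.comp ι₁) (ι₂.comp G₁) ?_ w
    rintro _ ⟨u, z, rfl⟩
    simp [hl₁, h₁, hG₁, hl₂]
  have c₂ (w) : F₂ (ι₂ w) = ι₃ (G₂ w) := by
    refine clm_eq_of_total R₂.rt.dense (F₂.comp ι₂) (ι₃.comp G₂) ?_ w
    rintro _ ⟨u, z, rfl⟩
    simp [hr₂, h₂, hG₂, hr₃]
  have c₃ (w) : F₃ (ι₃ w) = ι₄ (G₃ w) := by
    refine clm_eq_of_total R₃.lt.dense (F₃.comp ι₃) (ι₄.comp G₃) ?_ w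
    rintro _ ⟨u, z, rfl⟩
    simp [hl₃, h₃, hG₃, hl₄]
  have c₅ (w) : F₅ (ι₅ w) = ι₆ (G₅ w) := by
    refine clm_eq_of_total R₅.lt.dense (F₅.comp ι₅) (ι₆.comp G₅) ?_ w
    rintro _ ⟨u, z, rfl⟩
    simp [hl₅, h₅, hG₅, hl₆]
  have c₆ (w) : F₆ (ι₆ w) = ι₄ (G₆ w) := by
    refine clm_eq_of_total R₆.rt.dense (F₆.comp ι₆) (ι₄.comp G₆) ?_ w
    rintro _ ⟨u, z, rfl⟩
    simp [hr₆, h₆, hG₆, hr₄]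
  have hQ := hex Q₁ Q₂ Q₃ Q₄ Q₅ Q₆ R₁ R₂ R₃ R₄ R₅ R₆ G₁ G₂ G₃ G₄ G₅ G₆
    (.of_clm G₁) (.of_clm G₂) (.of_clm G₃) (.of_clm G₄) (.of_clm G₅) (.of_clm G₆)
    hG₁ hG₂ hG₃ hG₄ hG₅ hG₆ (R₁.rp x v)
  rw [← hr₁, c₁, c₂, c₃, hQ, hG₄, ← c₆, ← c₅, hr₅]

/-! ### Full embeddings -/

/-- An embedding along `π : A →⋆ₙₐ[ℂ] B` whose range generates the target as a Hilbert
`B`-module. -/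
structure FullEmb (π : A →⋆ₙₐ[ℂ] B) (W : Corr A) (Z : Corr B) (f : W.X →L[ℂ] Z.X) : Prop
    extends Emb π W Z f where
  total : closure (Submodule.span ℂ {z : Z.X | ∃ x b, z = Z.ract (f x) b} : Set Z.X) = Set.univ

namespace IsTensor

variable {Z Z' TZ : Corr B} {mZ : Z.X → Z'.X → TZ.X}

/-- Generating subsets of the factors generate the tensor product as a Hilbert module. -/
lemma total_ract (ht : IsTensor Z Z' TZ mZ) {α β : Type*} {f : α → Z.X} {g : β → Z'.X}
    (hf : closure (Submodule.span ℂ {z : Z.X | ∃ x b, z = Z.ract (f x) b} : Set Z.X) = Set.univ)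
    (hg : closure (Submodule.span ℂ {z : Z'.X | ∃ y b, z = Z'.ract (g y) b} : Set Z'.X) =
      Set.univ) :
    closure (Submodule.span ℂ {z : TZ.X | ∃ x y b, z = TZ.ract (mZ (f x) (g y)) b} : Set TZ.X) =
      Set.univ := by
  refine total_of_forall_mem (ht.total_of_total hf hg) ?_
  rintro _ ⟨_, ⟨x, b, rfl⟩, w, -, rfl⟩
  rw [ht.balanced]
  refine mem_of_total hg (Submodule.isClosed_topologicalClosure _) (ht.preTensor.mulL (f x)) ?_ _
  rintro _ ⟨y, c, rfl⟩
  exact subset_closure (Submodule.subset_span ⟨x, y, c, (ht.ract _ _ _).symm⟩)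

/-- The tensor product of two full embeddings is a full embedding. -/
lemma exists_fullEmb {π : A →⋆ₙₐ[ℂ] B} (ht : IsTensor Z Z' TZ mZ) {W V T : Corr A}
    {m : W.X → V.X → T.X} (hm : IsTensor W V T m) {f : W.X →L[ℂ] Z.X} {g : V.X →L[ℂ] Z'.X}
    (hf : FullEmb π W Z f) (hg : FullEmb π V Z' g) :
    ∃ J : T.X →L[ℂ] TZ.X, FullEmb π T TZ J ∧ ∀ x y, J (m x y) = mZ (f x) (g y) := by
  obtain ⟨J, hJ, hJm⟩ := (ht.preTensor_of_emb hf.toEmb hg.toEmb).exists_emb hm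
  refine ⟨J, ⟨hJ, total_of_forall_mem (ht.total_ract hf.total hg.total) ?_⟩, hJm⟩
  rintro _ ⟨x, y, b, rfl⟩
  exact subset_closure (Submodule.subset_span ⟨m x y, b, by rw [hJm]⟩)

end IsTensor

/-- A realization of `W ⊗_A B` contains `W`. -/
lemma MixedMod.exists_map {π : A →⋆ₙₐ[ℂ] B} {W : Corr A} {Z : Corr B} {m : W.X → B → Z.X}
    (h : MixedMod W B π Z m) :
    ∃ f : W.X →L[ℂ] Z.X, (∀ x y, Z.inner (f x) (f y) = π (W.inner x y)) ∧
      ∀ x b, m x b = Z.ract (f x) b := by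
  have hr : Set.range (fun i : W.X × A => W.ract i.1 i.2) = {z | ∃ x a, z = W.ract x a} := by
    ext z; simp [eq_comm]
  obtain ⟨f, hf, hfi⟩ := exists_map_of_inner π (fun i : W.X × A => W.ract i.1 i.2)
    (fun i : W.X × A => m i.1 (π i.2)) (by rw [hr]; exact W.ract_total)
    fun i j => by
      simp only [h.inner, W.inner_ract_left, W.inner_ract_right, map_mul, map_star]
  have hf' (x a) : f (W.ract x a) = m x (π a) := hf (x, a)
  have hπ : Continuous π := AddMonoidHomClass.continuous_of_bound π 1 fun a => by
    rw [one_mul]; exact NonUnitalStarAlgHom.norm_apply_le π a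
  have hin (y : W.X) (b : B) (x : W.X) : Z.inner (m y b) (f x) = star b * π (W.inner y x) := by
    let Φ : A →L[ℂ] B := ⟨(π : A →ₗ[ℂ] B), hπ⟩
    refine clm_eq_of_total W.ract_total ((Z.innerR (m y b)).comp f)
      ((ContinuousLinearMap.mul ℂ B (star b)).comp (Φ.comp (W.innerR y))) ?_ x
    rintro _ ⟨x, a, rfl⟩
    change Z.inner (m y b) (f (W.ract x a)) = star b * π (W.inner y (W.ract x a))
    rw [hf', h.inner, W.inner_ract_right, map_mul]
  refine ⟨f, hfi, fun x b => Z.eq_of_inner_total h.dense ?_⟩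
  rintro _ ⟨y, c, rfl⟩
  rw [h.inner, Z.inner_ract_right, hin, mul_assoc]

/-- If `A` acts on `W ⊗_A B` through `W`, then `W` embeds fully into `W ⊗_A B`. -/
lemma MixedMod.exists_fullEmb {π : A →⋆ₙₐ[ℂ] B} {W : Corr A} {Z : Corr B} {m : W.X → B → Z.X}
    (h : MixedMod W B π Z m) (hl : ∀ a x b, Z.lactL (π a) (m x b) = m (W.lactL a x) b) :
    ∃ f : W.X →L[ℂ] Z.X, FullEmb π W Z f ∧ ∀ x b, m x b = Z.ract (f x) b := by
  obtain ⟨f, hf, hm⟩ := h.exists_map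
  refine ⟨f, ⟨⟨hf, fun a x => Z.eq_of_ract fun b => ?_⟩, ?_⟩, hm⟩
  · rw [Z.ract_lact, ← hm, ← hm, hl]
  · simp only [← hm]
    exact h.dense

/-! ### Vectors of a represented correspondence acting on an embedded one -/

/-- The star homomorphism underlying a representation. -/
def IsStarHom.toHom {π : A → B} (h : IsStarHom π) : A →⋆ₙₐ[ℂ] B where
  toFun := π
  map_smul' := h.map_smul
  map_zero' := by simpa using h.map_smul 0 0
  map_add' := h.map_add
  map_mul' := h.map_mul
  map_star' := h.map_star

lemma IsRep.preTensor_ract {π : A →⋆ₙₐ[ℂ] B} {W V : Corr A} {Z : Corr B} {t : V.X → B}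
    (ht : IsRep V π t) {f : W.X →L[ℂ] Z.X} (hf : Emb π W Z f) :
    PreTensor π W V Z fun x e => Z.ract (f x) (t e) where
  inner x e x' e' := by
    rw [Z.inner_ract_left, Z.inner_ract_right, hf.inner, ← ht.lact, ht.inner]
  lact a x e := by rw [← Z.ract_lact, hf.lact]

lemma IsRep.preTensor_lact {π : A →⋆ₙₐ[ℂ] B} {W V : Corr A} {Z : Corr B} {t : V.X → B}
    (ht : IsRep V π t) {f : W.X →L[ℂ] Z.X} (hf : Emb π W Z f) :
    PreTensor π V W Z fun e x => Z.lactL (t e) (f x) where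
  inner e x e' x' := by
    rw [Z.lact_adjoint, ← ContinuousLinearMap.comp_apply, ← Z.lact_mul, ht.inner, hf.lact,
      hf.inner]
  lact a e x := by rw [ht.lact, Z.lact_mul]; rfl

/-- An isomorphism of correspondences, as a continuous linear map. -/
def CorrIso.toCLM {W Z : Corr A} (f : CorrIso W Z) : W.X →L[ℂ] Z.X :=
  LinearMap.mkContinuous
    { toFun := f.toFun
      map_add' := f.map_add
      map_smul' := f.map_smul } 1 fun x => by
        rw [one_mul]
        refine le_of_sq_le_sq ?_ (norm_nonneg _)
        rw [Z.norm_eq, W.norm_eq]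
        exact (congrArg _ (f.map_inner x x)).le

@[simp] lemma CorrIso.toCLM_apply {W Z : Corr A} (f : CorrIso W Z) (x : W.X) :
    f.toCLM x = f.toFun x := rfl

lemma Emb.comp_iso {π : A →⋆ₙₐ[ℂ] B} {W V : Corr A} {Z : Corr B} {g : V.X →L[ℂ] Z.X}
    (hg : Emb π V Z g) (f : CorrIso W V) : Emb π W Z (g.comp f.toCLM) where
  inner x y := by simp [hg.inner, f.map_inner]
  lact a x := by simp [hg.lact, f.map_lact]

/-- A full embedding `f` of `Y` into `Z`, together with an embedding `g` of `Y ⊗_A Y₁` such that a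
representation `t` of `Y₁` acts on `Z` through a flip `θ : Y₁ ⊗_A Y → Y ⊗_A Y₁`. -/
structure FlipEmb (π : A →⋆ₙₐ[ℂ] B) {Y₁ Y T T' : Corr A} (mT : Y₁.X → Y.X → T.X)
    (mT' : Y.X → Y₁.X → T'.X) (θ : T.X → T'.X) (t : Y₁.X → B) (Z : Corr B)
    (f : Y.X →L[ℂ] Z.X) (g : T'.X →L[ℂ] Z.X) : Prop where
  full : FullEmb π Y Z f
  emb : Emb π T' Z g
  map_mul : ∀ y e, g (mT' y e) = Z.ract (f y) (t e)
  lact : ∀ e y, Z.lactL (t e) (f y) = g (θ (mT e y))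

lemma ECorrData.exists_flipEmb {Y₁ Y T T' : Corr A} {mT : Y₁.X → Y.X → T.X}
    {mT' : Y.X → Y₁.X → T'.X} {θ : T.X → T'.X} {C : CPAlg Y₁} {Z : Corr C.O}
    {m : Y.X → C.O → Z.X} (h : ECorrData Y₁ Y T mT T' mT' θ C Z m) (hT' : IsTensor Y Y₁ T' mT') :
    ∃ f g, FlipEmb C.isRep.hom.toHom mT mT' θ C.t Z f g ∧ ∀ y b, m y b = Z.ract (f y) b := by
  obtain ⟨f, hf, hm⟩ := MixedMod.exists_fullEmb (π := C.isRep.hom.toHom) h.mod h.lact_pi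
  have ht : IsRep Y₁ C.isRep.hom.toHom C.t := C.isRep
  obtain ⟨g, hg, hgm⟩ := (ht.preTensor_ract hf.toEmb).exists_emb hT'
  obtain ⟨μ, hμ, hμm, hμt⟩ := h.lact_t
  refine ⟨f, g, ⟨hf, hg, hgm, fun e y => Z.eq_of_ract fun b => ?_⟩, hm⟩
  rw [Z.ract_lact, ← hm, hμt]
  refine clm_eq_of_total hT'.dense (hμ b).toCLM ((Z.ractR b).comp g) ?_ _
  rintro _ ⟨y, u, rfl⟩
  simp [hμm, hgm, hm, Z.ract_mul]

/-! ### The isomorphism induced by a flip on the absorbed tensor products -/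

section Absorption

variable {π : A →⋆ₙₐ[ℂ] B} {Yi Yj Tij Tji : Corr A} {mij : Yi.X → Yj.X → Tij.X}
  {mji : Yj.X → Yi.X → Tji.X} {Zi Zj TZ TZr : Corr B} {mmi : Yi.X → B → Zi.X}
  {mmj : Yj.X → B → Zj.X} {mZ : Zi.X → Zj.X → TZ.X} {mZr : Zj.X → Zi.X → TZr.X}
  {fi : Yi.X →L[ℂ] Zi.X} {fj : Yj.X →L[ℂ] Zj.X} {J : Tij.X →L[ℂ] TZ.X} {Jr : Tji.X →L[ℂ] TZr.X}

/-- The absorption isomorphism `(Yi ⊗ B) ⊗_B (Yj ⊗ B) → Yi ⊗ Yj ⊗ B` on generators. -/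
lemma absorption_ract (hij : IsTensor Yi Yj Tij mij) (hZ : IsTensor Zi Zj TZ mZ)
    (hi : Emb π Yi Zi fi) (hj : Emb π Yj Zj fj) (hmi : ∀ x b, mmi x b = Zi.ract (fi x) b)
    (hmj : ∀ y b, mmj y b = Zj.ract (fj y) b) (hJ : ∀ x y, J (mij x y) = mZ (fi x) (fj y))
    {Pl : Corr B} {q : Tij.X → B → Pl.X} (hq : MixedMod Tij B π Pl q)
    {p : Yi.X → Zj.X → Pl.X} (hqp : ∀ x y b, q (mij x y) b = p x (mmj y b))
    (ν : TZ.X →L[ℂ] Pl.X) (hν : ∀ x b z, ν (mZ (mmi x b) z) = p x (Zj.lactL b z))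
    (u : Tij.X) (b : B) : ν (TZ.ract (J u) b) = q u b := by
  obtain ⟨g, -, hg⟩ := hq.exists_map
  rw [hg]
  refine clm_eq_of_total (hij.total_of_total Yi.ract_total (S' := Set.univ) (by simp))
    (ν.comp ((TZ.ractR b).comp J)) ((Pl.ractR b).comp g) ?_ u
  rintro _ ⟨_, ⟨x, a, rfl⟩, y, -, rfl⟩
  simp only [ContinuousLinearMap.comp_apply, Corr.ractR_apply]
  rw [← hg, hJ, hZ.ract, map_ract_of_inner hi.inner, ← hmi, hν, ← Zj.ract_lact, hj.lact, ← hmj,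
    ← hqp, hij.balanced]

/-- On generators, `ν⁻¹ (θ ⊗ 1) ν` is given by `θ`. -/
lemma RTheta.exists_map {θ : CorrIso Tij Tji} {R : TZ.X → TZr.X}
    (r : RTheta B π Yi Yj Tij Tji mij mji θ.toFun Zi Zj mmi mmj TZ TZr mZ mZr R)
    (hij : IsTensor Yi Yj Tij mij) (hji : IsTensor Yj Yi Tji mji)
    (hZ : IsTensor Zi Zj TZ mZ) (hZr : IsTensor Zj Zi TZr mZr)
    (hi : Emb π Yi Zi fi) (hj : Emb π Yj Zj fj) (hmi : ∀ x b, mmi x b = Zi.ract (fi x) b)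
    (hmj : ∀ y b, mmj y b = Zj.ract (fj y) b)
    (hJ : FullEmb π Tij TZ J) (hJm : ∀ x y, J (mij x y) = mZ (fi x) (fj y))
    (hJr : FullEmb π Tji TZr Jr) (hJrm : ∀ y x, Jr (mji y x) = mZr (fj y) (fi x)) :
    ∃ U : TZ.X →L[ℂ] TZr.X, (∀ z, U z = R z) ∧ (∀ z w, TZr.inner (U z) (U w) = TZ.inner z w) ∧
      ∀ u, U (J u) = Jr (θ.toFun u) := by
  have hr : Set.range (fun i : Tij.X × B => TZ.ract (J i.1) i.2) =
      {z | ∃ u b, z = TZ.ract (J u) b} := by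
    ext z; simp [eq_comm]
  obtain ⟨U, hU, hUi⟩ := exists_map_of_inner (NonUnitalStarAlgHom.id ℂ B)
    (fun i : Tij.X × B => TZ.ract (J i.1) i.2)
    (fun i : Tij.X × B => TZr.ract (Jr (θ.toFun i.1)) i.2) (by rw [hr]; exact hJ.total)
    fun i j => by
      simp [TZ.inner_ract_left, TZ.inner_ract_right, TZr.inner_ract_left, TZr.inner_ract_right,
        hJ.inner, hJr.inner, θ.map_inner]
  have hU' (u b) : U (TZ.ract (J u) b) = TZr.ract (Jr (θ.toFun u)) b := hU (u, b)
  have hν := absorption_ract hij hZ hi hj hmi hmj hJm r.hq r.q_compat r.hν.1.toCLM r.hν.2.2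
  have hνr := absorption_ract hji hZr hj hi hmj hmi hJrm r.hqr r.q_compatr r.hνr.1.toCLM r.hνr.2.2
  simp only [IsCLMap.toCLM_apply] at hν hνr
  refine ⟨U, fun z => r.hνr.2.1.1 ?_, hUi, fun u => TZr.eq_of_ract fun b => ?_⟩
  · rw [r.hR]
    refine clm_eq_of_total hJ.total (r.hνr.1.toCLM.comp U) (r.hΘ.1.toCLM.comp r.hν.1.toCLM) ?_ z
    rintro _ ⟨u, b, rfl⟩
    simp [hU', hν, hνr, r.hΘ.2]
  · rw [← hU', map_ract_of_inner hUi]; rfl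

end Absorption

/-! ### Equivariance for the action of the Cuntz–Pimsner algebra -/

lemma CPAlg.map_lact {Y : Corr A} (C : CPAlg Y) {W Z : Corr C.O} (U : W.X →L[ℂ] Z.X)
    (hU : Function.Surjective U) (hi : ∀ x y, Z.inner (U x) (U y) = W.inner x y)
    (hπ : ∀ a x, U (W.lactL (C.π a) x) = Z.lactL (C.π a) (U x))
    (ht : ∀ e x, U (W.lactL (C.t e) x) = Z.lactL (C.t e) (U x)) (b : C.O) (x : W.X) :
    U (W.lactL b x) = Z.lactL b (U x) := by
  suffices b ∈ {b | ∀ x, U (W.lactL b x) = Z.lactL b (U x)} from this x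
  refine C.gen {b | ∀ x, U (W.lactL b x) = Z.lactL b (U x)} ?_ (fun a x => hπ a x)
    (fun e x => ht e x) ?_ ?_ ?_ ?_ b
  · simp only [Set.ofPred_forall]
    exact isClosed_iInter fun x => isClosed_eq (U.comp (W.lactR x)).continuous
      (Z.lactR (U x)).continuous
  · intro p q hp hq x
    simp [W.lact_add, Z.lact_add, hp x, hq x]
  · intro p q hp hq x
    simp [W.lact_mul, Z.lact_mul, hp _, hq x]
  · intro c p hp x
    simp [W.lact_smul, Z.lact_smul, hp x]
  · intro p hp x
    refine Z.eq_of_inner fun s => ?_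
    obtain ⟨y, rfl⟩ := hU s
    rw [hi, W.inner_lact_right, Z.inner_lact_right, star_star, ← hp, hi]

section Flip

variable {π : A →⋆ₙₐ[ℂ] B} {Y₁ Yi Yj T₁i Ti₁ T₁j Tj₁ Tij : Corr A} {m₁i : Y₁.X → Yi.X → T₁i.X}
  {mi₁ : Yi.X → Y₁.X → Ti₁.X} {m₁j : Y₁.X → Yj.X → T₁j.X} {mj₁ : Yj.X → Y₁.X → Tj₁.X}
  {mij : Yi.X → Yj.X → Tij.X} {θi : CorrIso T₁i Ti₁} {θj : CorrIso T₁j Tj₁} {t : Y₁.X → B}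
  {Zi Zj TZ : Corr B} {mZ : Zi.X → Zj.X → TZ.X} {fi : Yi.X →L[ℂ] Zi.X} {gi : Ti₁.X →L[ℂ] Zi.X}
  {fj : Yj.X →L[ℂ] Zj.X} {gj : Tj₁.X →L[ℂ] Zj.X} {J : Tij.X →L[ℂ] TZ.X}

lemma FlipEmb.eTrip_left (hi : FlipEmb π m₁i mi₁ θi.toFun t Zi fi gi)
    (hj : FlipEmb π m₁j mj₁ θj.toFun t Zj fj gj) (ht : IsRep Y₁ π t)
    (hZ : IsTensor Zi Zj TZ mZ) (hJ : Emb π Tij TZ J)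
    (hJm : ∀ x y, J (mij x y) = mZ (fi x) (fj y)) :
    ETrip π Y₁ Yi Yj T₁i m₁i Tij mij TZ (fun v y => mZ (gi (θi.toFun v)) (fj y))
      (fun e u => TZ.lactL (t e) (J u)) where
  lt := hZ.preTensor_of_emb (hi.emb.comp_iso θi) hj.full.toEmb
  rt := ht.preTensor_lact hJ
  compat e x y := by rw [← hi.lact, hJm, hZ.lact]

lemma FlipEmb.eTrip_mid (hi : FlipEmb π m₁i mi₁ θi.toFun t Zi fi gi)
    (hj : FlipEmb π m₁j mj₁ θj.toFun t Zj fj gj) (hZ : IsTensor Zi Zj TZ mZ) :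
    ETrip π Yi Y₁ Yj Ti₁ mi₁ T₁j m₁j TZ (fun v y => mZ (gi v) (fj y))
      (fun x v => mZ (fi x) (gj (θj.toFun v))) where
  lt := hZ.preTensor_of_emb hi.emb hj.full.toEmb
  rt := hZ.preTensor_of_emb hi.full.toEmb (hj.emb.comp_iso θj)
  compat x e y := by rw [hi.map_mul, hZ.balanced, hj.lact]

lemma FlipEmb.eTrip_right (hi : FlipEmb π m₁i mi₁ θi.toFun t Zi fi gi)
    (hj : FlipEmb π m₁j mj₁ θj.toFun t Zj fj gj) (ht : IsRep Y₁ π t)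
    (hZ : IsTensor Zi Zj TZ mZ) (hJ : Emb π Tij TZ J)
    (hJm : ∀ x y, J (mij x y) = mZ (fi x) (fj y)) :
    ETrip π Yi Yj Y₁ Tij mij Tj₁ mj₁ TZ (fun u e => TZ.ract (J u) (t e))
      (fun x v => mZ (fi x) (gj v)) where
  lt := ht.preTensor_ract hJ
  rt := hZ.preTensor_of_emb hi.full.toEmb hj.emb
  compat x y e := by rw [hJm, hZ.ract, hj.map_mul]

/-- The hexagonal relation makes the flip commute with the vectors of the absorbed
correspondence. -/
lemma FlipEmb.map_lact {Tji : Corr A} {mji : Yj.X → Yi.X → Tji.X} {θij : CorrIso Tij Tji}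
    {TZr : Corr B} {mZr : Zj.X → Zi.X → TZr.X} {Jr : Tji.X →L[ℂ] TZr.X}
    (hπ : Function.Injective π) (hex : HexProp Y₁ Yi Yj T₁i Ti₁ T₁j Tj₁ Tij Tji m₁i mi₁ m₁j mj₁
      mij mji θi.toFun θj.toFun θij.toFun)
    (h₁i : IsTensor Y₁ Yi T₁i m₁i) (hi₁ : IsTensor Yi Y₁ Ti₁ mi₁) (h₁j : IsTensor Y₁ Yj T₁j m₁j)
    (hj₁ : IsTensor Yj Y₁ Tj₁ mj₁) (hij : IsTensor Yi Yj Tij mij) (hji : IsTensor Yj Yi Tji mji)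
    (hi : FlipEmb π m₁i mi₁ θi.toFun t Zi fi gi) (hj : FlipEmb π m₁j mj₁ θj.toFun t Zj fj gj)
    (ht : IsRep Y₁ π t) (hZ : IsTensor Zi Zj TZ mZ) (hZr : IsTensor Zj Zi TZr mZr)
    (hJ : FullEmb π Tij TZ J) (hJm : ∀ x y, J (mij x y) = mZ (fi x) (fj y))
    (hJr : Emb π Tji TZr Jr) (hJrm : ∀ y x, Jr (mji y x) = mZr (fj y) (fi x))
    (U : TZ.X →L[ℂ] TZr.X) (hU : ∀ u, U (J u) = Jr (θij.toFun u))
    (hUr : ∀ z b, U (TZ.ract z b) = TZr.ract (U z) b) (e : Y₁.X) (z : TZ.X) :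
    U (TZ.lactL (t e) z) = TZr.lactL (t e) (U z) := by
  have key (u : Tij.X) : U (TZ.lactL (t e) (J u)) = TZr.lactL (t e) (Jr (θij.toFun u)) :=
    HexProp.eq_of_eTrip hπ hex h₁i hi₁ h₁j hj₁ hij hji
      (hi.eTrip_left hj ht hZ hJ.toEmb hJm) (hi.eTrip_mid hj hZ)
      (hi.eTrip_right hj ht hZ hJ.toEmb hJm) (hj.eTrip_right hi ht hZr hJr hJrm)
      (hj.eTrip_left hi ht hZr hJr hJrm) (hj.eTrip_mid hi hZr)
      (.id ℂ _) (.id ℂ _) U (.id ℂ _) (.id ℂ _) (fun _ _ => rfl) (fun _ _ => rfl)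
      (fun u e => by rw [hUr, hU]) (fun _ _ => rfl) (fun _ _ => rfl) e u
  refine clm_eq_of_total hJ.total (U.comp (TZ.lactL (t e))) ((TZr.lactL (t e)).comp U) ?_ z
  rintro _ ⟨u, b, rfl⟩
  simp only [ContinuousLinearMap.comp_apply]
  rw [← TZ.ract_lact, hUr, key, hUr, hU, TZr.ract_lact]

end Flip

/-! ### Transport of the hexagonal relations -/

lemma Trip.eTrip {π : A →⋆ₙₐ[ℂ] B} {W₁ W₂ W₃ T₁₂ T₂₃ : Corr A} {m₁₂ : W₁.X → W₂.X → T₁₂.X}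
    {m₂₃ : W₂.X → W₃.X → T₂₃.X} {Z₁ Z₂ Z₃ S₁₂ S₂₃ P : Corr B} {n₁₂ : Z₁.X → Z₂.X → S₁₂.X}
    {n₂₃ : Z₂.X → Z₃.X → S₂₃.X} (r : Trip Z₁ Z₂ Z₃ S₁₂ n₁₂ S₂₃ n₂₃ P)
    {f₁ : W₁.X →L[ℂ] Z₁.X} {f₂ : W₂.X →L[ℂ] Z₂.X} {f₃ : W₃.X →L[ℂ] Z₃.X}
    {J₁₂ : T₁₂.X →L[ℂ] S₁₂.X} {J₂₃ : T₂₃.X →L[ℂ] S₂₃.X} (h₁ : Emb π W₁ Z₁ f₁)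
    (h₃ : Emb π W₃ Z₃ f₃) (h₁₂ : Emb π T₁₂ S₁₂ J₁₂) (h₂₃ : Emb π T₂₃ S₂₃ J₂₃)
    (e₁₂ : ∀ x y, J₁₂ (m₁₂ x y) = n₁₂ (f₁ x) (f₂ y))
    (e₂₃ : ∀ y z, J₂₃ (m₂₃ y z) = n₂₃ (f₂ y) (f₃ z)) :
    ETrip π W₁ W₂ W₃ T₁₂ m₁₂ T₂₃ m₂₃ P (fun u z => r.lp (J₁₂ u) (f₃ z))
      (fun x v => r.rp (f₁ x) (J₂₃ v)) where
  lt := r.lt.preTensor_of_emb h₁₂ h₃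
  rt := r.rt.preTensor_of_emb h₁ h₂₃
  compat x y z := by rw [e₁₂, e₂₃, r.compat]

namespace IsTensor

variable {W V T W' V' T' : Corr A} {m : W.X → V.X → T.X} {m' : W'.X → V'.X → T'.X}

/-- A map of tensor products given by a right-linear map on the second factors is
right-linear. -/
lemma map_ract_of_apply (ht : IsTensor W V T m) (ht' : IsTensor W' V' T' m') {F : T.X → T'.X}
    (hF : IsCLMap F) {f : W.X → W'.X} {g : V.X → V'.X}
    (hFm : ∀ x y, F (m x y) = m' (f x) (g y)) (hg : ∀ y a, g (V.ract y a) = V'.ract (g y) a)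
    (z : T.X) (a : A) : F (T.ract z a) = T'.ract (F z) a := by
  refine clm_eq_of_total ht.dense (hF.toCLM.comp (T.ractR a)) ((T'.ractR a).comp hF.toCLM) ?_ z
  rintro _ ⟨x, y, rfl⟩
  simp [ht.ract, ht'.ract, hFm, hg]

end IsTensor

/-- A flip of tensor products over `B` which extends the flip of a generating system satisfies the
hexagonal relations. -/
lemma GenSys.hexProp_of_fullEmb {k : ℕ} (G : GenSys A k) {π : A →⋆ₙₐ[ℂ] B}
    (hπ : Function.Injective π) {Z : Fin k → Corr B} {TZ : Fin k → Fin k → Corr B}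
    {mZ : ∀ i j, (Z i).X → (Z j).X → (TZ i j).X} {f : ∀ i, (G.Y i).X →L[ℂ] (Z i).X}
    (hf : ∀ i, FullEmb π (G.Y i) (Z i) (f i)) {J : ∀ i j, (G.T i j).X →L[ℂ] (TZ i j).X}
    (hJ : ∀ i j, FullEmb π (G.T i j) (TZ i j) (J i j))
    (hJm : ∀ i j x y, J i j (G.tmul i j x y) = mZ i j (f i x) (f j y))
    {R : ∀ i j, (TZ i j).X → (TZ j i).X}
    (hRJ : ∀ i j u, R i j (J i j u) = J j i ((G.θ i j).toFun u))
    (hRr : ∀ i j z b, R i j ((TZ i j).ract z b) = (TZ j i).ract (R i j z) b) (i j l : Fin k) :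
    HexProp (Z i) (Z j) (Z l) (TZ i j) (TZ j i) (TZ i l) (TZ l i) (TZ j l) (TZ l j)
      (mZ i j) (mZ j i) (mZ i l) (mZ l i) (mZ j l) (mZ l j) (R i j) (R i l) (R j l) := by
  intro P₁ P₂ P₃ P₄ P₅ P₆ R₁ R₂ R₃ R₄ R₅ R₆ F₁ F₂ F₃ F₄ F₅ F₆ c₁ c₂ c₃ c₄ c₅ c₆ h₁ h₂ h₃ h₄ h₅ h₆ w
  have E {a b c : Fin k} {P : Corr B} (r : Trip (Z a) (Z b) (Z c) (TZ a b) (mZ a b) (TZ b c)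
      (mZ b c) P) := r.eTrip (hf a).toEmb (hf c).toEmb (hJ a b).toEmb (hJ b c).toEmb (hJm a b)
        (hJm b c)
  have key (x : (G.Y i).X) (v : (G.T j l).X) :
      F₃ (F₂ (F₁ (R₁.rp (f i x) (J j l v)))) = F₆ (F₅ (F₄ (R₁.rp (f i x) (J j l v)))) := by
    rw [h₄, hRJ]
    exact HexProp.eq_of_eTrip hπ (G.hex i j l) (G.isTensor _ _) (G.isTensor _ _) (G.isTensor _ _)
      (G.isTensor _ _) (G.isTensor _ _) (G.isTensor _ _) (E R₁) (E R₂) (E R₃) (E R₄) (E R₅) (E R₆)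
      c₁.toCLM c₂.toCLM c₃.toCLM c₅.toCLM c₆.toCLM (fun u z => by simp [h₁, hRJ])
      (fun u z => by simp [h₂, hRJ]) (fun u z => by simp [h₃, hRJ]) (fun u z => by simp [h₅, hRJ])
      (fun u z => by simp [h₆, hRJ]) x v
  have r₁ := R₁.lt.map_ract_of_apply R₂.lt c₁ (g := id) h₁ fun _ _ => rfl
  have r₂ := R₂.rt.map_ract_of_apply R₃.rt c₂ (f := id) h₂ (hRr _ _)
  have r₃ := R₃.lt.map_ract_of_apply R₄.lt c₃ (g := id) h₃ fun _ _ => rfl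
  have r₄ := R₁.rt.map_ract_of_apply R₅.rt c₄ (f := id) h₄ (hRr _ _)
  have r₅ := R₅.lt.map_ract_of_apply R₆.lt c₅ (g := id) h₅ fun _ _ => rfl
  have r₆ := R₆.rt.map_ract_of_apply R₄.rt c₆ (f := id) h₆ (hRr _ _)
  refine clm_eq_of_total (R₁.rt.total_ract (hf i).total (hJ j l).total)
    (c₃.toCLM.comp (c₂.toCLM.comp c₁.toCLM)) (c₆.toCLM.comp (c₅.toCLM.comp c₄.toCLM)) ?_ w
  rintro _ ⟨x, v, b, rfl⟩
  simp only [ContinuousLinearMap.comp_apply, IsCLMap.toCLM_apply, r₁, r₂, r₃, r₄, r₅, r₆, key]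

/-- Proposition `M prop`.  If `(Y, θ)` is a generating
system of `k` nondegenerate regular `A`-correspondences, then
`(ℰY, ℛθ)` — with `ℰY_i = Y_i ⊗_A 𝒪(Y₁)` and
`ℛθ_{ij} = ν_{ji}⁻¹ (θ_{ij} ⊗ 1) ν_{ij}` — is a generating system of
`𝒪(Y₁)`-correspondences:  each `ℛθ_{ij}` is an isomorphism,
`ℛθ_{ii} = id`, `ℛθ_{ij} = ℛθ_{ji}⁻¹`, and the `ℛθ_{ij}` satisfy the
hexagonal relations. -/
theorem EY_Rtheta_is_generating_system
    {A : Type u} [NonUnitalCStarAlgebra A]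
    {k : ℕ} (G : GenSys A k) (hk : 0 < k)
    (C : CPAlg (G.Y ⟨0, hk⟩))
    (Z : Fin k → Corr C.O)
    (mm : ∀ i, (G.Y i).X → C.O → (Z i).X)
    (hZ : ∀ i, ECorr G ⟨0, hk⟩ i C (Z i) (mm i))
    (TZ : Fin k → Fin k → Corr C.O)
    (mZ : ∀ i j, (Z i).X → (Z j).X → (TZ i j).X)
    (hTZ : ∀ i j, IsTensor (Z i) (Z j) (TZ i j) (mZ i j))
    (R : ∀ i j, (TZ i j).X → (TZ j i).X)
    (hR : ∀ i j, Nonempty (RTheta C.O C.π (G.Y i) (G.Y j) (G.T i j) (G.T j i)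
      (G.tmul i j) (G.tmul j i) ((G.θ i j).toFun)
      (Z i) (Z j) (mm i) (mm j) (TZ i j) (TZ j i) (mZ i j) (mZ j i) (R i j))) :
    (∀ i j, IsCorrIsoFun (TZ i j) (TZ j i) (R i j)) ∧
    (∀ i z, R i i z = z) ∧
    (∀ i j z, R j i (R i j z) = z) ∧
    ∀ i j l, HexProp (Z i) (Z j) (Z l)
      (TZ i j) (TZ j i) (TZ i l) (TZ l i) (TZ j l) (TZ l j)
      (mZ i j) (mZ j i) (mZ i l) (mZ l i) (mZ j l) (mZ l j)
      (R i j) (R i l) (R j l) := by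
  let π : A →⋆ₙₐ[ℂ] C.O := C.isRep.hom.toHom
  have hπ : Function.Injective π := C.inj
  have ht : IsRep (G.Y ⟨0, hk⟩) π C.t := C.isRep
  choose f g hfg hm using fun i => (hZ i).exists_flipEmb (G.isTensor i ⟨0, hk⟩)
  have hf (i) : FullEmb π (G.Y i) (Z i) (f i) := (hfg i).full
  choose J hJ hJm using fun i j => (hTZ i j).exists_fullEmb (G.isTensor i j) (hf i) (hf j)
  choose U hUR hUi hUJ using fun i j => (hR i j).some.exists_map (π := π) (G.isTensor i j)
    (G.isTensor j i) (hTZ i j) (hTZ j i) (hf i).toEmb (hf j).toEmb (hm i) (hm j) (hJ i j) (hJm i j)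
    (hJ j i) (hJm j i)
  obtain rfl : R = fun i j => (U i j : (TZ i j).X → (TZ j i).X) := by
    funext i j z
    exact (hUR i j z).symm
  have hUr (i j z b) : U i j ((TZ i j).ract z b) = (TZ j i).ract (U i j z) b :=
    map_ract_of_inner (π := .id ℂ C.O) (hUi i j) z b
  have hθ (i) (u : (G.T i i).X) : (G.θ i i).toFun u = u := by
    refine clm_eq_of_total (G.isTensor i i).dense (G.θ i i).toCLM (.id ℂ _) ?_ u
    rintro _ ⟨x, y, rfl⟩
    exact G.θ_diag i x y
  have hsymm (i j z) : U j i (U i j z) = z := by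
    refine clm_eq_of_total (hJ i j).total ((U j i).comp (U i j)) (.id ℂ _) ?_ z
    rintro _ ⟨u, b, rfl⟩
    simp [hUr, hUJ, G.θ_symm]
  refine ⟨fun i j => ?_, fun i z => ?_, hsymm, G.hexProp_of_fullEmb hπ hf hJ hJm hUJ hUr⟩
  · have hbij : Function.Bijective (U i j) :=
      Function.bijective_iff_has_inverse.mpr ⟨U j i, hsymm i j, hsymm j i⟩
    refine ⟨hbij, map_add _, map_smul _, hUi i j, hUr i j, ?_⟩
    refine C.map_lact (U i j) hbij.2 (hUi i j) (fun a x => ?_) fun e x => ?_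
    · refine clm_eq_of_total (hJ i j).total ((U i j).comp ((TZ i j).lactL (C.π a)))
        (((TZ j i).lactL (C.π a)).comp (U i j)) ?_ x
      rintro _ ⟨u, b, rfl⟩
      have h₁ := (hJ i j).lact a u
      have h₂ := (hJ j i).lact a ((G.θ i j).toFun u)
      change (TZ i j).lactL (C.π a) _ = _ at h₁
      change (TZ j i).lactL (C.π a) _ = _ at h₂
      simp only [ContinuousLinearMap.comp_apply]
      rw [← (TZ i j).ract_lact, h₁, hUr, hUJ, hUr, hUJ, ← (TZ j i).ract_lact, h₂,
        (G.θ i j).map_lact]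
    · exact FlipEmb.map_lact hπ (G.hex ⟨0, hk⟩ i j) (G.isTensor _ _) (G.isTensor _ _)
        (G.isTensor _ _) (G.isTensor _ _) (G.isTensor _ _) (G.isTensor _ _) (hfg i) (hfg j) ht
        (hTZ i j) (hTZ j i) (hJ i j) (hJm i j) (hJ j i).toEmb (hJm j i) (U i j) (hUJ i j)
        (hUr i j) e x
  · refine clm_eq_of_total (hJ i i).total (U i i) (.id ℂ _) ?_ z
    rintro _ ⟨u, b, rfl⟩
    simp [hUr, hUJ, hθ]
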